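/- arXiv:2101.12353 — 4 statements merged into one kernel-verified Lean document; each statement's English description precedes it below -/
import Mathlib

section
/- Suppose $W \ge 7d+1$, $L \ge 2$ and $N \le (W-d-1) \lfloor \frac{W-d-1}{6d} \rfloor \lfloor \frac{L}{2} \rfloor$. Then for any real numbers $z_0 < z_1 < \dots < z_N < z_{N+1}$, every function in $\mathcal{S}^d(z_0,\dots,z_{N+1})$ can be represented by a ReLU neural network of width at most $W$ and depth at most $L$, i.e., $\mathcal{S}^d(z_0,\dots,z_{N+1}) \subseteq \mathcal{NN}(W,L)$. -/
open MeasureTheory Filter Topology Metric Set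
open scoped ENNReal NNReal

noncomputable section

/-! ### ReLU neural networks -/

/-- Forward pass of a ReLU network: `nnForward N M b l x` is the output of the `l`-th hidden
layer (after applying the ReLU) on input `x`. Here `N l` is the number of neurons in layer `l`,
`M l` and `b l` are the weight matrix and the bias vector of the affine map `A_l`. -/
def nnForward (N : ℕ → ℕ)
    (M : ∀ l : ℕ, Matrix (Fin (N (l + 1))) (Fin (N l)) ℝ)
    (b : ∀ l : ℕ, Fin (N (l + 1)) → ℝ) :
    ∀ l : ℕ, (Fin (N 0) → ℝ) → Fin (N l) → ℝ
  | 0 => fun x => x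
  | l + 1 => fun x i => max ((M l).mulVec (nnForward N M b l x) i + b l i) 0

/-- `NNset m d W L` is the set of functions `ℝ^m → ℝ^d` that are representable by ReLU neural
networks with width at most `W` and depth (number of hidden layers) at most `L`. -/
def NNset (m d W L : ℕ) : Set (EuclideanSpace ℝ (Fin m) → EuclideanSpace ℝ (Fin d)) :=
  {φ | ∃ L' : ℕ, 1 ≤ L' ∧ L' ≤ L ∧
    ∃ (N : ℕ → ℕ) (h0 : N 0 = m) (hL : N (L' + 1) = d),
      (∀ l, 1 ≤ l → l ≤ L' → N l ≤ W) ∧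
      ∃ (M : ∀ l : ℕ, Matrix (Fin (N (l + 1))) (Fin (N l)) ℝ)
        (b : ∀ l : ℕ, Fin (N (l + 1)) → ℝ),
        ∀ (x : EuclideanSpace ℝ (Fin m)) (i : Fin d),
          φ x i = (M L').mulVec (nnForward N M b L' (fun j => x (Fin.cast h0 j)))
              (Fin.cast hL.symm i) + b L' (Fin.cast hL.symm i)}

/-- ReLU networks with one-dimensional input, viewed as functions on `ℝ`. -/
def NNset1 (d W L : ℕ) : Set (ℝ → EuclideanSpace ℝ (Fin d)) :=
  {φ | (fun x : EuclideanSpace ℝ (Fin 1) => φ (x 0)) ∈ NNset 1 d W L}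

/-! ### Wasserstein distances -/

/-- `WppENN p μ ν` is the `p`-th power of the `p`-th Wasserstein distance, i.e. the optimal
transportation cost `inf_γ ∫ dist(x,y)^p dγ` over all couplings `γ` of `μ` and `ν`. -/
def WppENN {E : Type*} [MeasurableSpace E] [PseudoEMetricSpace E] (p : ℝ)
    (μ ν : Measure E) : ℝ≥0∞ :=
  ⨅ (γ : Measure (E × E)) (_ : γ.map Prod.fst = μ ∧ γ.map Prod.snd = ν),
    ∫⁻ z, edist z.1 z.2 ^ p ∂γ

/-- The `p`-th Wasserstein distance `W_p(μ,ν)` (valued in `ℝ≥0∞`). -/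
def Wdist {E : Type*} [MeasurableSpace E] [PseudoEMetricSpace E] (p : ℝ)
    (μ ν : Measure E) : ℝ≥0∞ :=
  WppENN p μ ν ^ (1 / p)

/-- `𝒫(n)`: the set of discrete probability measures on `ℝ^d` supported on at most `n` points. -/
def discreteP (d n : ℕ) : Set (Measure (EuclideanSpace ℝ (Fin d))) :=
  {μ | ∃ (x : Fin n → EuclideanSpace ℝ (Fin d)) (w : Fin n → ℝ≥0∞),
    ∑ i, w i = 1 ∧ μ = ∑ i, w i • Measure.dirac (x i)}

/-- The `q`-th absolute moment `M_q^q(μ) = ∫ |x|^q dμ(x)` (valued in `ℝ≥0∞`). -/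
def moment (q : ℝ) {d : ℕ} (μ : Measure (EuclideanSpace ℝ (Fin d))) : ℝ≥0∞ :=
  ∫⁻ x, ENNReal.ofReal ‖x‖ ^ q ∂μ

/-- `M_q(μ) = (∫ |x|^q dμ(x))^{1/q}` as a real number (junk value if the moment is infinite). -/
def Mq (q : ℝ) {d : ℕ} (μ : Measure (EuclideanSpace ℝ (Fin d))) : ℝ :=
  (moment q μ).toReal ^ (1 / q)

/-! ### Covering numbers and dimensions -/

/-- The `ε`-covering number of a set `S`: the smallest number of open balls of radius `ε`
needed to cover `S` (`⊤` if no finite cover exists). -/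
def coveringNumber {E : Type*} [PseudoMetricSpace E] (ε : ℝ) (S : Set E) : ℕ∞ :=
  ⨅ (t : Finset E) (_ : S ⊆ ⋃ x ∈ t, Metric.ball x ε), (t.card : ℕ∞)

/-- The `(ε,δ)`-covering number of a measure `μ`:
`inf { N_ε(S) : μ(S) ≥ 1 - δ }`. -/
def measureCoveringNumber {E : Type*} [PseudoMetricSpace E] [MeasurableSpace E]
    (ε δ : ℝ) (μ : Measure E) : ℕ∞ :=
  ⨅ (S : Set E) (_ : 1 - ENNReal.ofReal δ ≤ μ S), coveringNumber ε S

/-- Base-2 logarithm of an extended natural number, valued in `ℝ≥0∞`. -/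
def elog2 (n : ℕ∞) : ℝ≥0∞ :=
  if n = ⊤ then ⊤ else ENNReal.ofReal (Real.logb 2 (n.toNat : ℝ))

/-- The upper dimension `d_r^*(μ) = limsup_{ε → 0} log₂ N_ε(μ, ε^r) / (-log₂ ε)`. -/
def upperDim {E : Type*} [PseudoMetricSpace E] [MeasurableSpace E] (r : ℝ)
    (μ : Measure E) : ℝ≥0∞ :=
  Filter.limsup
    (fun ε : ℝ => elog2 (measureCoveringNumber ε (ε ^ r) μ) / ENNReal.ofReal (-Real.logb 2 ε))
    (𝓝[>] (0 : ℝ))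

/-- The lower dimension `d_*(μ) = lim_{δ → 0} liminf_{ε → 0} log₂ N_ε(μ,δ) / (-log₂ ε)`;
since the inner quantity is antitone in `δ`, the limit as `δ → 0⁺` equals the supremum over
`δ > 0`. -/
def lowerDim {E : Type*} [PseudoMetricSpace E] [MeasurableSpace E] (μ : Measure E) : ℝ≥0∞ :=
  ⨆ (δ : ℝ) (_ : 0 < δ),
    Filter.liminf
      (fun ε : ℝ => elog2 (measureCoveringNumber ε δ μ) / ENNReal.ofReal (-Real.logb 2 ε))
      (𝓝[>] (0 : ℝ))

/-- The (upper) Minkowski dimension of a set, via covering numbers. -/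
def setDimM {E : Type*} [PseudoMetricSpace E] (S : Set E) : ℝ≥0∞ :=
  Filter.limsup
    (fun ε : ℝ => elog2 (coveringNumber ε S) / ENNReal.ofReal (-Real.logb 2 ε))
    (𝓝[>] (0 : ℝ))

/-- The Minkowski dimension of a measure: `inf { dim_M S : μ(S) = 1 }`. -/
def measureDimM {E : Type*} [PseudoMetricSpace E] [MeasurableSpace E]
    (μ : Measure E) : ℝ≥0∞ :=
  ⨅ (S : Set E) (_ : μ S = 1), setDimM S

/-- The Hausdorff dimension of a measure: `inf { dim_H S : μ(S) = 1 }`. -/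
def measureDimH {E : Type*} [EMetricSpace E] [MeasurableSpace E] (μ : Measure E) : ℝ≥0∞ :=
  ⨅ (S : Set E) (_ : μ S = 1), dimH S

/-- The support of a measure on a metric space: points all of whose balls have positive
measure. -/
def msupport {E : Type*} [PseudoMetricSpace E] [MeasurableSpace E] (μ : Measure E) : Set E :=
  {x | ∀ ε : ℝ, 0 < ε → 0 < μ (Metric.ball x ε)}

/-! ### f-divergences -/

/-- Conversion `EReal → ℝ≥0∞` (negative values go to `0`). -/
def erealToENNReal (x : EReal) : ℝ≥0∞ :=
  if x = ⊤ then ⊤ else ENNReal.ofReal x.toReal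

/-- Integral of an `EReal`-valued function: difference of the lower integrals of the positive
and negative parts. -/
def eintegral {α : Type*} [MeasurableSpace α] (μ : Measure α) (g : α → EReal) : EReal :=
  ((∫⁻ x, erealToENNReal (g x) ∂μ : ℝ≥0∞) : EReal)
    - ((∫⁻ x, erealToENNReal (-(g x)) ∂μ : ℝ≥0∞) : EReal)

/-- `f(0) := lim_{t ↓ 0} f(t)` (as an `EReal`; realized as a `limsup`, which agrees with the
limit whenever the limit exists, e.g. for convex `f`). -/
def limZero (f : ℝ → ℝ) : EReal :=
  Filter.limsup (fun t : ℝ => ((f t : ℝ) : EReal)) (𝓝[>] (0 : ℝ))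

/-- `f^*(0) := lim_{t → ∞} f(t)/t` (as an `EReal`; realized as a `limsup`). -/
def limInfty (f : ℝ → ℝ) : EReal :=
  Filter.limsup (fun t : ℝ => ((f t / t : ℝ) : EReal)) Filter.atTop

/-- The `f`-divergence `D_f(μ ‖ ν)`, defined through the reference measure `τ = μ + ν` with
densities `p = dμ/dτ`, `q = dν/dτ`:
`D_f(μ‖ν) = ∫_{q > 0} f(p/q) q dτ + f^*(0) μ({q = 0})`,
with the conventions `f(0) = lim_{t↓0} f t` on `{p = 0, q > 0}`. -/
def fDiv (f : ℝ → ℝ) {α : Type*} [MeasurableSpace α] (μ ν : Measure α) : EReal :=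
  eintegral ((μ + ν).restrict {x | ν.rnDeriv (μ + ν) x ≠ 0})
    (fun x =>
      if μ.rnDeriv (μ + ν) x = 0 then
        limZero f * (((ν.rnDeriv (μ + ν) x).toReal : ℝ) : EReal)
      else
        ((f ((μ.rnDeriv (μ + ν) x / ν.rnDeriv (μ + ν) x).toReal)
            * (ν.rnDeriv (μ + ν) x).toReal : ℝ) : EReal))
  + limInfty f * ((μ {x | ν.rnDeriv (μ + ν) x = 0} : ℝ≥0∞) : EReal)

/-! ### Piecewise linear functions -/

/-- The space `𝒮^d(z_0, …, z_{N+1})` of continuous piecewise linear functions `ℝ → ℝ^d` with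
breakpoints only at `z_0 < … < z_{N+1}`, constant on `(-∞, z_0)` and `(z_{N+1}, ∞)`. -/
def SpaceS (d N : ℕ) (z : Fin (N + 2) → ℝ) : Set (ℝ → EuclideanSpace ℝ (Fin d)) :=
  {φ | Continuous φ ∧
    (∀ x ≤ z 0, φ x = φ (z 0)) ∧
    (∀ x, z (Fin.last (N + 1)) ≤ x → φ x = φ (z (Fin.last (N + 1)))) ∧
    (∀ i : Fin (N + 1), ∃ a b : EuclideanSpace ℝ (Fin d),
      ∀ x ∈ Set.Icc (z i.castSucc) (z i.succ), φ x = x • a + b)}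

/-- A continuous piecewise linear function `ℝ → ℝ^d`. -/
def IsCPwL {d : ℕ} (φ : ℝ → EuclideanSpace ℝ (Fin d)) : Prop :=
  Continuous φ ∧ ∃ (k : ℕ) (z : Fin (k + 1) → ℝ), Monotone z ∧
    (∃ a b : EuclideanSpace ℝ (Fin d), ∀ x ∈ Set.Iic (z 0), φ x = x • a + b) ∧
    (∀ i : Fin k, ∃ a b : EuclideanSpace ℝ (Fin d),
      ∀ x ∈ Set.Icc (z i.castSucc) (z i.succ), φ x = x • a + b) ∧
    (∃ a b : EuclideanSpace ℝ (Fin d), ∀ x ∈ Set.Ici (z (Fin.last k)), φ x = x • a + b)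

end

/-! ### Hat functions -/

/-- The hat function supported on `[l, r]` with peak value `1` at `p`. -/
noncomputable def hat (l p r v : ℝ) : ℝ := max (min ((v - l) / (p - l)) ((r - v) / (r - p))) 0

lemma hat_of_le_left {l p r v : ℝ} (hlp : l < p) (hv : v ≤ l) : hat l p r v = 0 :=
  max_eq_right (min_le_of_left_le
    (div_nonpos_of_nonpos_of_nonneg (by linarith) (by linarith)))

lemma hat_of_right_le {l p r v : ℝ} (hpr : p < r) (hv : r ≤ v) : hat l p r v = 0 :=
  max_eq_right (min_le_of_right_le
    (div_nonpos_of_nonpos_of_nonneg (by linarith) (by linarith)))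

lemma hat_of_mem_left {l p r v : ℝ} (hlp : l < p) (hpr : p < r) (hv : l ≤ v) (hv' : v ≤ p) :
    hat l p r v = (v - l) / (p - l) := by
  have h1 : (v - l) / (p - l) ≤ 1 := (div_le_one (by linarith)).2 (by linarith)
  have h2 : 1 ≤ (r - v) / (r - p) := (one_le_div (by linarith)).2 (by linarith)
  rw [hat, min_eq_left (h1.trans h2), max_eq_left]
  exact div_nonneg (by linarith) (by linarith)

lemma hat_of_mem_right {l p r v : ℝ} (hlp : l < p) (hpr : p < r) (hv : p ≤ v) (hv' : v ≤ r) :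
    hat l p r v = (r - v) / (r - p) := by
  have h1 : 1 ≤ (v - l) / (p - l) := (one_le_div (by linarith)).2 (by linarith)
  have h2 : (r - v) / (r - p) ≤ 1 := (div_le_one (by linarith)).2 (by linarith)
  rw [hat, min_eq_right (h2.trans h1), max_eq_left]
  exact div_nonneg (by linarith) (by linarith)

lemma hat_pos {l p r v : ℝ} (hlp : l < p) (hpr : p < r) (hv : l < v) (hv' : v < r) :
    0 < hat l p r v :=
  lt_max_of_lt_left (lt_min (div_pos (by linarith) (by linarith))
    (div_pos (by linarith) (by linarith)))

/-- `f` coincides with an affine function on `[a, b]`. -/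
def IsAffineOn (f : ℝ → ℝ) (a b : ℝ) : Prop :=
  ∃ α β : ℝ, ∀ v ∈ Icc a b, f v = α + β * v

lemma isAffineOn_affine (α β a b : ℝ) : IsAffineOn (fun v => α + β * v) a b :=
  ⟨α, β, fun _ _ => rfl⟩

lemma IsAffineOn.add {f g : ℝ → ℝ} {a b : ℝ} (hf : IsAffineOn f a b) (hg : IsAffineOn g a b) :
    IsAffineOn (fun v => f v + g v) a b := by
  obtain ⟨α, β, h⟩ := hf
  obtain ⟨γ, δ, h'⟩ := hg
  exact ⟨α + γ, β + δ, fun v hv => by simp only [h v hv, h' v hv]; ring⟩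

lemma IsAffineOn.const_mul {f : ℝ → ℝ} {a b : ℝ} (c : ℝ) (hf : IsAffineOn f a b) :
    IsAffineOn (fun v => c * f v) a b := by
  obtain ⟨α, β, h⟩ := hf
  exact ⟨c * α, c * β, fun v hv => by simp only [h v hv]; ring⟩

lemma IsAffineOn.sum {κ : Type*} {s : Finset κ} {f : κ → ℝ → ℝ} {a b : ℝ}
    (hf : ∀ k ∈ s, IsAffineOn (f k) a b) : IsAffineOn (fun v => ∑ k ∈ s, f k v) a b := by
  classical
  induction s using Finset.induction_on with
  | empty => exact ⟨0, 0, fun v _ => by simp⟩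
  | insert k s hk ih =>
    simp only [Finset.sum_insert hk]
    exact (hf k (Finset.mem_insert_self k s)).add
      (ih fun k' hk' => hf k' (Finset.mem_insert_of_mem hk'))

lemma IsAffineOn.eqOn {f g : ℝ → ℝ} {a b : ℝ} (hf : IsAffineOn f a b) (hg : IsAffineOn g a b)
    (hab : a < b) (ha : f a = g a) (hb : f b = g b) : EqOn f g (Icc a b) := by
  obtain ⟨α, β, h⟩ := hf
  obtain ⟨γ, δ, h'⟩ := hg
  have ma : a ∈ Icc a b := left_mem_Icc.2 hab.le
  have mb : b ∈ Icc a b := right_mem_Icc.2 hab.le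
  rw [h a ma, h' a ma] at ha
  rw [h b mb, h' b mb] at hb
  have hβ : β = δ := by
    have : (β - δ) * (b - a) = 0 := by linarith
    rcases mul_eq_zero.1 this with h0 | h0 <;> linarith
  intro v hv
  rw [h v hv, h' v hv]
  subst hβ
  linarith

lemma isAffineOn_hat {z : ℕ → ℝ} (hz : StrictMono z) {i j k : ℕ} (hij : i < j) (hjk : j < k)
    (m : ℕ) : IsAffineOn (hat (z i) (z j) (z k)) (z m) (z (m + 1)) := by
  have h1 := hz hij
  have h2 := hz hjk
  rcases Nat.lt_or_ge m i with hm | hm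
  · have := hz.monotone (Nat.succ_le_of_lt hm)
    exact ⟨0, 0, fun v hv => by rw [hat_of_le_left h1 (hv.2.trans this)]; ring⟩
  have hmi := hz.monotone hm
  rcases Nat.lt_or_ge m j with hm | hm
  · have := hz.monotone (Nat.succ_le_of_lt hm)
    exact ⟨-z i / (z j - z i), 1 / (z j - z i), fun v hv => by
      rw [hat_of_mem_left h1 h2 (hmi.trans hv.1) (hv.2.trans this)]; ring⟩
  have hmj := hz.monotone hm
  rcases Nat.lt_or_ge m k with hm | hm
  · have := hz.monotone (Nat.succ_le_of_lt hm)
    exact ⟨z k / (z k - z j), -1 / (z k - z j), fun v hv => by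
      rw [hat_of_mem_right h1 h2 (hmj.trans hv.1) (hv.2.trans this)]; ring⟩
  have hmk := hz.monotone hm
  exact ⟨0, 0, fun v hv => by rw [hat_of_right_le h2 (hmk.trans hv.1)]; ring⟩

/-- A lower triangular system with nonzero diagonal is solvable. -/
lemma exists_triangular_solution (T : ℕ → ℕ → ℝ) (hT : ∀ k m, m < k → T k m = 0)
    (hT' : ∀ k, T k k ≠ 0) (c : ℕ → ℝ) (M : ℕ) :
    ∃ a : ℕ → ℝ, ∀ m < M, ∑ k ∈ Finset.range M, a k * T k m = c m := by
  induction M with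
  | zero => exact ⟨0, by simp⟩
  | succ M ih =>
    obtain ⟨a, ha⟩ := ih
    let t := (c M - ∑ k ∈ Finset.range M, a k * T k M) / T M M
    refine ⟨Function.update a M t, fun m hm => ?_⟩
    have hsum : ∑ k ∈ Finset.range M, Function.update a M t k * T k m
        = ∑ k ∈ Finset.range M, a k * T k m :=
      Finset.sum_congr rfl fun k hk => by
        rw [Function.update_of_ne (Finset.mem_range.1 hk).ne]
    rw [Finset.sum_range_succ, hsum, Function.update_self]
    rcases Nat.lt_succ_iff_lt_or_eq.1 hm with h | rfl
    · rw [ha m h, hT M m h, mul_zero, add_zero]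
    · have := hT' m
      simp only [t]
      field_simp
      ring

/-! ### Realizing sums of hat functions by a single ReLU -/

/-- The continuous function vanishing left of `a`, with slopes `s₁, s₂, s₃, s₄` on the intervals
between `a, b, p, c, e`, and constant right of `e`. -/
def fourSlopes (s₁ s₂ s₃ s₄ a b p c e v : ℝ) : ℝ :=
  s₁ * (max (v - a) 0 - max (v - b) 0) + s₂ * (max (v - b) 0 - max (v - p) 0)
    + s₃ * (max (v - p) 0 - max (v - c) 0) + s₄ * (max (v - c) 0 - max (v - e) 0)

lemma exists_fourSlopes {a b p c e l r : ℝ} (hab : a < b) (hce : c < e) (hbl : b ≤ l)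
    (hlp : l < p) (hpr : p < r) (hrc : r ≤ c) :
    ∃ s₁ s₂ s₃ s₄ : ℝ,
      (∀ v, v ≤ a → fourSlopes s₁ s₂ s₃ s₄ a b p c e v = 0) ∧
      (∀ v, e ≤ v → fourSlopes s₁ s₂ s₃ s₄ a b p c e v = 0) ∧
      (∀ v, v ≤ b → fourSlopes s₁ s₂ s₃ s₄ a b p c e v ≤ 0) ∧
      (∀ v, c ≤ v → fourSlopes s₁ s₂ s₃ s₄ a b p c e v ≤ 0) ∧
      (∀ v, max (fourSlopes s₁ s₂ s₃ s₄ a b p c e v) 0 = hat l p r v) := by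
  have d1 : 0 < b - a := by linarith
  have d2 : 0 < p - l := by linarith
  have d3 : 0 < r - p := by linarith
  have d4 : 0 < e - c := by linarith
  set s₁ := -((l - b) / (p - l)) / (b - a) with h₁
  set s₂ := 1 / (p - l) with h₂
  set s₃ := -1 / (r - p) with h₃
  set s₄ := ((c - r) / (r - p)) / (e - c) with h₄
  have e1 : s₁ * (b - a) = - (s₂ * (l - b)) := by rw [h₁, h₂]; field_simp
  have e2 : s₂ * (p - l) = 1 := by rw [h₂]; field_simp
  have e3 : s₃ * (r - p) = -1 := by rw [h₃]; field_simp
  have e4 : s₄ * (e - c) = - (s₃ * (c - r)) := by rw [h₃, h₄]; field_simp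
  have n1 : s₁ ≤ 0 := div_nonpos_of_nonpos_of_nonneg
    (neg_nonpos.2 (div_nonneg (by linarith) d2.le)) d1.le
  have n2 : 0 < s₂ := by positivity
  have n3 : s₃ < 0 := div_neg_of_neg_of_pos (by norm_num) d3
  have n4 : 0 ≤ s₄ := div_nonneg (div_nonneg (by linarith) d3.le) d4.le
  have v0 : ∀ v, v ≤ a → fourSlopes s₁ s₂ s₃ s₄ a b p c e v = 0 := fun v hv => by
    simp only [fourSlopes]
    rw [max_eq_right (by linarith), max_eq_right (by linarith), max_eq_right (by linarith),
      max_eq_right (by linarith), max_eq_right (by linarith)]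
    ring
  have v1 : ∀ v, a ≤ v → v ≤ b → fourSlopes s₁ s₂ s₃ s₄ a b p c e v = s₁ * (v - a) :=
    fun v hv hv' => by
    simp only [fourSlopes]
    rw [max_eq_left (by linarith), max_eq_right (by linarith), max_eq_right (by linarith),
      max_eq_right (by linarith), max_eq_right (by linarith)]
    ring
  have v2 : ∀ v, b ≤ v → v ≤ p → fourSlopes s₁ s₂ s₃ s₄ a b p c e v = s₂ * (v - l) :=
    fun v hv hv' => by
    simp only [fourSlopes]
    rw [max_eq_left (by linarith), max_eq_left (by linarith), max_eq_right (by linarith),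
      max_eq_right (by linarith), max_eq_right (by linarith)]
    linear_combination e1
  have v3 : ∀ v, p ≤ v → v ≤ c → fourSlopes s₁ s₂ s₃ s₄ a b p c e v = s₃ * (v - r) :=
    fun v hv hv' => by
    simp only [fourSlopes]
    rw [max_eq_left (by linarith), max_eq_left (by linarith), max_eq_left (by linarith),
      max_eq_right (by linarith), max_eq_right (by linarith)]
    linear_combination e1 + e2 + e3
  have v4 : ∀ v, c ≤ v → v ≤ e → fourSlopes s₁ s₂ s₃ s₄ a b p c e v = s₄ * (v - e) :=
    fun v hv hv' => by
    simp only [fourSlopes]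
    rw [max_eq_left (by linarith), max_eq_left (by linarith), max_eq_left (by linarith),
      max_eq_left (by linarith), max_eq_right (by linarith)]
    linear_combination e1 + e2 + e3 + e4
  have v5 : ∀ v, e ≤ v → fourSlopes s₁ s₂ s₃ s₄ a b p c e v = 0 := fun v hv => by
    simp only [fourSlopes]
    rw [max_eq_left (by linarith), max_eq_left (by linarith), max_eq_left (by linarith),
      max_eq_left (by linarith), max_eq_left (by linarith)]
    linear_combination e1 + e2 + e3 + e4
  have left : ∀ v, v ≤ b → fourSlopes s₁ s₂ s₃ s₄ a b p c e v ≤ 0 := fun v hv => by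
    rcases le_total v a with h | h
    · exact (v0 v h).le
    · rw [v1 v h hv]
      exact mul_nonpos_of_nonpos_of_nonneg n1 (by linarith)
  have right : ∀ v, c ≤ v → fourSlopes s₁ s₂ s₃ s₄ a b p c e v ≤ 0 := fun v hv => by
    rcases le_total e v with h | h
    · exact (v5 v h).le
    · rw [v4 v hv h]
      exact mul_nonpos_of_nonneg_of_nonpos n4 (by linarith)
  refine ⟨s₁, s₂, s₃, s₄, v0, v5, left, right, fun v => ?_⟩
  rcases le_total v b with h | hb
  · rw [max_eq_right (left v h), hat_of_le_left hlp (h.trans hbl)]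
  rcases le_total c v with h | hc
  · rw [max_eq_right (right v h), hat_of_right_le hpr (hrc.trans h)]
  rcases le_total v p with hp | hp
  · rw [v2 v hb hp]
    rcases le_total v l with hl | hl
    · rw [hat_of_le_left hlp hl, max_eq_right]
      exact mul_nonpos_of_nonneg_of_nonpos n2.le (by linarith)
    · rw [hat_of_mem_left hlp hpr hl hp, max_eq_left (mul_nonneg n2.le (by linarith)), h₂]
      ring
  · rw [v3 v hp hc]
    rcases le_total r v with hr | hr
    · rw [hat_of_right_le hpr hr, max_eq_right]
      exact mul_nonpos_of_nonpos_of_nonneg n3.le (by linarith)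
    · rw [hat_of_mem_right hlp hpr hp hr,
        max_eq_left (mul_nonneg_of_nonpos_of_nonpos n3.le (by linarith)), h₃]
      ring

lemma max_sum_eq_sum_max {κ : Type*} (s : Finset κ) (P : κ → ℝ)
    (h : ∀ i ∈ s, ∀ j ∈ s, i ≠ j → 0 < P i → P j = 0) :
    max (∑ j ∈ s, P j) 0 = ∑ j ∈ s, max (P j) 0 := by
  by_cases hex : ∃ i ∈ s, 0 < P i
  · obtain ⟨i, hi, hpos⟩ := hex
    rw [Finset.sum_eq_single_of_mem i hi fun j hj hji => h i hi j hj hji.symm hpos,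
      Finset.sum_eq_single_of_mem i hi fun j hj hji => by
        rw [h i hi j hj hji.symm hpos, max_self]]
  · push Not at hex
    rw [max_eq_right (Finset.sum_nonpos hex)]
    exact (Finset.sum_eq_zero fun j hj => max_eq_right (hex j hj)).symm

/-- The functions that are affine combinations of the neurons `v ↦ max (v - ξ j) 0` and of the
identity. -/
def reluSpan {κ : Type*} (ξ : κ → ℝ) : Submodule ℝ (ℝ → ℝ) :=
  Submodule.span ℝ (insert 1 (insert id (range fun (j : κ) (v : ℝ) => max (v - ξ j) 0)))

lemma exists_mem_reluSpan_eqOn {n : ℕ} {ξ : ℕ → ℝ} (hξ : StrictMono ξ) (m : ℕ) :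
    ∃ u ∈ reluSpan (fun j : Fin n => ξ (j + 2)),
      ∀ v ∈ Icc (ξ 1) (ξ (n + 2)), u v = max (v - ξ m) 0 := by
  rcases Nat.lt_or_ge m 2 with hm | hm
  · refine ⟨id - ξ m • 1, Submodule.sub_mem _ ?_ (Submodule.smul_mem _ _ ?_), fun v hv => ?_⟩
    · exact Submodule.subset_span (by simp)
    · exact Submodule.subset_span (by simp)
    · have := hξ.monotone (Nat.le_of_lt_succ hm)
      rw [max_eq_left (by linarith [hv.1])]
      simp
  rcases Nat.lt_or_ge m (n + 2) with hm' | hm'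
  · refine ⟨fun v => max (v - ξ m) 0, Submodule.subset_span ?_, fun v _ => rfl⟩
    refine mem_insert_of_mem _ (mem_insert_of_mem _ ⟨⟨m - 2, by omega⟩, ?_⟩)
    simp only [Nat.sub_add_cancel hm]
  · refine ⟨0, Submodule.zero_mem _, fun v hv => ?_⟩
    have := hξ.monotone hm'
    rw [max_eq_right (by linarith [hv.2])]
    rfl

/-- A nonnegative combination of hat functions whose peaks are every third breakpoint is the
ReLU of a continuous piecewise linear function with those breakpoints. -/
lemma exists_max_eq_sum_hat {n : ℕ} {ξ l r : ℕ → ℝ} (hξ : StrictMono ξ)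
    (hl : ∀ j < n, ξ (j + 1) ≤ l j) (hl' : ∀ j < n, l j < ξ (j + 2))
    (hr : ∀ j < n, ξ (j + 2) < r j) (hr' : ∀ j < n, r j ≤ ξ (j + 3))
    (h : ℕ → ℝ) (hh : ∀ j, 0 ≤ h j) (c : ℕ) :
    ∃ g ∈ reluSpan (fun j : Fin n => ξ (j + 2)), ∀ v ∈ Icc (ξ 1) (ξ (n + 2)),
      max (g v) 0 = ∑ j ∈ Finset.range n with j % 3 = c, h j * hat (l j) (ξ (j + 2)) (r j) v := by
  choose u hu huv using exists_mem_reluSpan_eqOn (n := n) hξ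
  choose! s₁ s₂ s₃ s₄ h0 h4 hleft hright hmax using fun j (hj : j < n) =>
    exists_fourSlopes (hξ (Nat.lt_succ_self j)) (hξ (Nat.lt_succ_self (j + 3)))
      (hl j hj) (hl' j hj) (hr j hj) (hr' j hj)
  let P : ℕ → ℝ → ℝ := fun j =>
    s₁ j • (u j - u (j + 1)) + s₂ j • (u (j + 1) - u (j + 2))
      + s₃ j • (u (j + 2) - u (j + 3)) + s₄ j • (u (j + 3) - u (j + 4))
  have hP : ∀ j, P j ∈ reluSpan (fun j : Fin n => ξ (j + 2)) := fun j =>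
    Submodule.add_mem _ (Submodule.add_mem _ (Submodule.add_mem _
      (Submodule.smul_mem _ _ (Submodule.sub_mem _ (hu _) (hu _)))
      (Submodule.smul_mem _ _ (Submodule.sub_mem _ (hu _) (hu _))))
      (Submodule.smul_mem _ _ (Submodule.sub_mem _ (hu _) (hu _))))
      (Submodule.smul_mem _ _ (Submodule.sub_mem _ (hu _) (hu _)))
  refine ⟨∑ j ∈ Finset.range n with j % 3 = c, h j • P j,
    Submodule.sum_mem _ fun j _ => Submodule.smul_mem _ _ (hP j), fun v hv => ?_⟩
  have hPv : ∀ j, P j v = fourSlopes (s₁ j) (s₂ j) (s₃ j) (s₄ j)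
      (ξ j) (ξ (j + 1)) (ξ (j + 2)) (ξ (j + 3)) (ξ (j + 4)) v := fun j => by
    simp only [P, fourSlopes, Pi.add_apply, Pi.smul_apply, Pi.sub_apply, smul_eq_mul,
      huv _ v hv]
  rw [Finset.sum_apply]
  simp only [Pi.smul_apply, smul_eq_mul, hPv]
  rw [max_sum_eq_sum_max]
  · refine Finset.sum_congr rfl fun j hj => ?_
    rw [← hmax j (Finset.mem_range.1 (Finset.mem_filter.1 hj).1) v,
      mul_max_of_nonneg _ _ (hh j), mul_zero]
  · intro i hi j hj hij hpos
    obtain ⟨hin, hi'⟩ := Finset.mem_filter.1 hi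
    obtain ⟨hjn, hj'⟩ := Finset.mem_filter.1 hj
    rw [Finset.mem_range] at hin hjn
    have hpos' := pos_of_mul_pos_right hpos (hh i)
    have hv1 : ξ (i + 1) < v := by
      by_contra! hle
      exact absurd hpos' (not_lt.2 (hleft i hin v hle))
    have hv2 : v < ξ (i + 3) := by
      by_contra! hle
      exact absurd hpos' (not_lt.2 (hright i hin v hle))
    rcases Nat.lt_or_gt_of_ne hij with hlt | hlt
    · rw [h0 j hjn v (hv2.le.trans (hξ.monotone (by omega))), mul_zero]
    · rw [h4 j hjn v ((hξ.monotone (by omega)).trans hv1.le), mul_zero]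

lemma continuous_of_mem_span {s : Set (ℝ → ℝ)} (hs : ∀ f ∈ s, Continuous f) {f : ℝ → ℝ}
    (hf : f ∈ Submodule.span ℝ s) : Continuous f := by
  induction hf using Submodule.span_induction with
  | mem f hf => exact hs f hf
  | zero => exact continuous_const
  | add f g _ _ hf hg => exact hf.add hg
  | smul a f _ hf => exact hf.const_smul a

lemma continuous_of_mem_reluSpan {κ : Type*} {ξ : κ → ℝ} {f : ℝ → ℝ} (hf : f ∈ reluSpan ξ) :
    Continuous f := by
  refine continuous_of_mem_span ?_ hf
  rintro f (rfl | rfl | ⟨j, rfl⟩)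
  · exact continuous_const
  · exact continuous_id
  · fun_prop

/-! ### Construction of networks layer by layer -/

/-- The affine combinations of a family of functions. -/
def affineCombinations {ι : Type*} (F : ℝ → ι → ℝ) : Submodule ℝ (ℝ → ℝ) :=
  Submodule.span ℝ (insert 1 (range fun i x => F x i))

lemma one_mem_affineCombinations {ι : Type*} (F : ℝ → ι → ℝ) : 1 ∈ affineCombinations F :=
  Submodule.subset_span (mem_insert _ _)

lemma const_mem_affineCombinations {ι : Type*} (F : ℝ → ι → ℝ) (c : ℝ) :
    (fun _ => c) ∈ affineCombinations F := by
  convert Submodule.smul_mem _ c (one_mem_affineCombinations F) using 1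
  ext
  simp

lemma coord_mem_affineCombinations {ι : Type*} (F : ℝ → ι → ℝ) (i : ι) :
    (fun x => F x i) ∈ affineCombinations F :=
  Submodule.subset_span (mem_insert_of_mem _ ⟨i, rfl⟩)

lemma exists_of_mem_affineCombinations {ι : Type*} [Fintype ι] {F : ℝ → ι → ℝ} {f : ℝ → ℝ}
    (hf : f ∈ affineCombinations F) :
    ∃ (a : ι → ℝ) (b : ℝ), ∀ x, f x = ∑ i, a i * F x i + b := by
  obtain ⟨b, g, hg, rfl⟩ := Submodule.mem_span_insert.1 hf
  obtain ⟨a, rfl⟩ := (Submodule.mem_span_range_iff_exists_fun ℝ).1 hg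
  refine ⟨a, b, fun x => ?_⟩
  simp [add_comm]

lemma mem_NNset_of_layers {d W L L' : ℕ} {ι : Type*} [Fintype ι] [Nonempty ι]
    (hι : Fintype.card ι = W) (hL : L' + 1 ≤ L) (F : ℕ → ℝ → ι → ℝ)
    (h0 : ∀ i, ∃ a b : ℝ, ∀ x, F 0 x i = max (a * x + b) 0)
    (hs : ∀ l < L', ∀ i, ∃ f ∈ affineCombinations (F l), ∀ x, F (l + 1) x i = max (f x) 0)
    (φ : ℝ → EuclideanSpace ℝ (Fin d))
    (hout : ∀ i, (fun x => φ x i) ∈ affineCombinations (F L')) :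
    (fun x : EuclideanSpace ℝ (Fin 1) => φ (x 0)) ∈ NNset 1 d W L := by
  choose a₀ b₀ hab₀ using h0
  have hs' : ∀ l i, ∃ (a : ι → ℝ) (b : ℝ), l < L' →
      ∀ x, F (l + 1) x i = max (∑ k, a k * F l x k + b) 0 := fun l i => by
    by_cases hl : l < L'
    · obtain ⟨f, hf, hFf⟩ := hs l hl i
      obtain ⟨a, b, hab⟩ := exists_of_mem_affineCombinations hf
      exact ⟨a, b, fun _ x => by rw [hFf, hab]⟩
    · exact ⟨0, 0, fun h => absurd h hl⟩
  choose A B hAB using hs'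
  choose Ao Bo hABo using fun i => exists_of_mem_affineCombinations (hout i)
  let e : Fin W ≃ ι := (Fintype.equivFinOfCardEq hι).symm
  let dec : ℕ → ι := fun k => if h : k < W then e ⟨k, h⟩ else Classical.arbitrary ι
  have hdec : ∀ k : Fin W, dec k = e k := fun k => by simp [dec]
  have hsum : ∀ (m : ℕ) (_ : m = W) (f : ι → ℝ), ∑ k : Fin m, f (dec k) = ∑ k, f k := by
    rintro m rfl f
    simp only [hdec]
    exact e.sum_comp f
  let N : ℕ → ℕ := fun l => if l = 0 then 1 else if l ≤ L' + 1 then W else d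
  have hN : ∀ l ≤ L', N (l + 1) = W := fun l hl => by simp [N, hl]
  have hNd : N (L' + 1 + 1) = d := by simp [N]
  let M : ∀ l : ℕ, Matrix (Fin (N (l + 1))) (Fin (N l)) ℝ := fun l =>
    Matrix.of fun i k =>
      if l = 0 then a₀ (dec i) else if l ≤ L' then A (l - 1) (dec i) (dec k)
      else if h : (i : ℕ) < d then Ao ⟨i, h⟩ (dec k) else 0
  let b : ∀ l : ℕ, Fin (N (l + 1)) → ℝ := fun l i =>
      if l = 0 then b₀ (dec i) else if l ≤ L' then B (l - 1) (dec i)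
      else if h : (i : ℕ) < d then Bo ⟨i, h⟩ else 0
  have key : ∀ l ≤ L', ∀ (x : Fin (N 0) → ℝ) (x₀ : ℝ), (∀ k, x k = x₀) → ∀ i,
      nnForward N M b (l + 1) x i = F l x₀ (dec i) := by
    intro l
    induction l with
    | zero =>
      intro _ x x₀ hx i
      have : ∑ k : Fin (N 0), a₀ (dec i) * x k = a₀ (dec i) * x₀ := by
        simp only [hx]
        simp [N]
      simp only [nnForward, Matrix.mulVec, dotProduct, M, b, Matrix.of_apply, if_true]
      rw [this, hab₀]
    | succ l ih =>
      intro hl x x₀ hx i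
      have hprev := ih (by omega) x x₀ hx
      rw [nnForward]
      simp only [Matrix.mulVec, dotProduct, hprev]
      simp only [M, b, Matrix.of_apply, Nat.add_eq_zero_iff, one_ne_zero, and_false, if_false,
        if_pos hl, Nat.add_sub_cancel]
      rw [hAB l _ (by omega), hsum _ (hN l (by omega)) fun k => A l (dec i) k * F l x₀ k]
  refine ⟨L' + 1, by omega, hL, N, by simp [N], hNd, ?_, M, b, ?_⟩
  · intro l hl hl'
    obtain ⟨m, rfl⟩ := Nat.exists_eq_add_of_le' hl
    exact (hN m (by omega)).le
  · intro x i
    simp only [Matrix.mulVec, dotProduct]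
    have hx := key L' le_rfl (fun j => x (Fin.cast (by simp [N]) j)) (x 0)
      fun k => congrArg x (Subsingleton.elim _ _)
    simp only [hx]
    simp only [M, b, Matrix.of_apply, Nat.add_eq_zero_iff, one_ne_zero, and_false, if_false,
      show ¬ (L' + 1 ≤ L') by omega, Fin.val_cast, i.isLt, dif_pos]
    rw [hsum _ (hN L' le_rfl) fun k => Ao i k * F L' (x 0) k]
    exact hABo i (x 0)

lemma max_clamp_sub {lo hi : ℝ} (hlohi : lo ≤ hi) {t : ℝ} (ht : lo ≤ t) (x : ℝ) :
    max (max lo (min x hi) - t) 0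
      = if t ≤ hi then max (x - t) 0 - max (x - hi) 0 else 0 := by
  split_ifs with h
  · rcases le_total x hi with hx | hx
    · rw [min_eq_left hx, max_eq_right (show x - hi ≤ 0 by linarith), sub_zero]
      rcases le_total lo x with hx' | hx'
      · rw [max_eq_right hx']
      · rw [max_eq_left hx', max_eq_right (by linarith), max_eq_right (by linarith)]
    · rw [min_eq_right hx, max_eq_right hlohi, max_eq_left (by linarith),
        max_eq_left (by linarith), max_eq_left (by linarith)]
      ring
  · push Not at h
    have := max_le hlohi (min_le_right x hi)
    exact max_eq_right (by linarith)

/-- Two hidden layers per summand suffice to compute a sum of functions, each a linear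
combination of ReLUs of continuous piecewise linear functions with few breakpoints. -/
lemma mem_NNset_of_sum {d n K L : ℕ} (hd : 0 < d) (hK : 0 < K) (hKL : 2 * K ≤ L) {lo hi : ℝ}
    (hlohi : lo ≤ hi) (ξ : ℕ → Fin n → ℝ) (hξ : ∀ s j, lo ≤ ξ s j)
    (G : ℕ → Fin n → ℝ → ℝ) (hG : ∀ s k, G s k ∈ reluSpan (ξ s))
    (ψ : ℕ → Fin d → ℝ → ℝ)
    (hψ : ∀ s i, ψ s i ∈ Submodule.span ℝ (range fun k v => max (G s k v) 0))
    (α β : Fin d → ℝ) (φ : ℝ → EuclideanSpace ℝ (Fin d))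
    (hφ : ∀ x i, φ x i = α i + β i * max lo (min x hi)
      + ∑ s ∈ Finset.range K, ψ s i (max lo (min x hi))) :
    (fun x : EuclideanSpace ℝ (Fin 1) => φ (x 0)) ∈ NNset 1 d (n + d + 1) L := by
  let cl : ℝ → ℝ := fun x => max lo (min x hi)
  have hcl : ∀ x, cl x ∈ Icc lo hi := fun x =>
    ⟨le_max_left _ _, max_le hlohi (min_le_right _ _)⟩
  let S : ℕ → Fin d → ℝ → ℝ := fun s i v => ∑ t ∈ Finset.range s, ψ t i v
  have hScont : ∀ s i, Continuous (S s i) := fun s i =>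
    continuous_finsetSum _ fun t _ => continuous_of_mem_span (by
      rintro f ⟨k, rfl⟩
      exact (continuous_of_mem_reluSpan (hG t k)).max continuous_const) (hψ t i)
  obtain ⟨C, hC⟩ : ∃ C : ℝ, ∀ s < K, ∀ i, ∀ v ∈ Icc lo hi, 0 ≤ S s i v + C := by
    have hcont : Continuous fun v => ∑ s ∈ Finset.range K, ∑ i, |S s i v| :=
      continuous_finsetSum _ fun s _ => continuous_finsetSum _ fun i _ => (hScont s i).abs
    obtain ⟨C, hC⟩ := isCompact_Icc.exists_bound_of_continuousOn (s := Icc lo hi)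
      hcont.continuousOn
    refine ⟨C, fun s hs i v hv => ?_⟩
    have h1 : |S s i v| ≤ ∑ i, |S s i v| :=
      Finset.single_le_sum (f := fun i => |S s i v|) (fun i _ => abs_nonneg _)
        (Finset.mem_univ i)
    have h2 : ∑ i, |S s i v| ≤ ∑ s ∈ Finset.range K, ∑ i, |S s i v| :=
      Finset.single_le_sum (f := fun s => ∑ i, |S s i v|)
        (fun s _ => Finset.sum_nonneg fun i _ => abs_nonneg _) (Finset.mem_range.2 hs)
    have h3 := (le_abs_self _).trans (hC v hv)
    have h4 := neg_abs_le (S s i v)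
    linarith
  let F : ℕ → ℝ → (Fin n ⊕ Fin d ⊕ Unit) → ℝ := fun l x => Sum.elim
    (fun k => if l = 0 then max (x - ξ 0 k) 0
      else if l % 2 = 0 then max (cl x - ξ (l / 2) k) 0 else max (G (l / 2) k (cl x)) 0)
    (Sum.elim (fun i => if l = 0 then max (x - hi) 0 else S (l / 2) i (cl x) + C)
      (fun _ => if l = 0 then max (x - lo) 0 else cl x - lo))
  have hneuron : ∀ l k, (fun x => F l x (Sum.inl k)) ∈ affineCombinations (F l) :=
    fun l k => coord_mem_affineCombinations _ _
  have hclmem : ∀ l, cl ∈ affineCombinations (F l) := fun l => by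
    have hunit := coord_mem_affineCombinations (F l) (Sum.inr (Sum.inr ()))
    by_cases hl : l = 0
    · have hacc := coord_mem_affineCombinations (F l) (Sum.inr (Sum.inl ⟨0, hd⟩))
      have := Submodule.add_mem _ (Submodule.sub_mem _ hunit hacc)
        (const_mem_affineCombinations (F l) lo)
      convert this using 1
      ext x
      have hx := max_clamp_sub hlohi le_rfl x
      rw [if_pos hlohi, max_eq_left (by simp)] at hx
      simp only [F, hl, Pi.add_apply, Pi.sub_apply, Sum.elim_inr, Sum.elim_inl, if_true]
      linarith
    · convert Submodule.add_mem _ hunit (const_mem_affineCombinations (F l) lo) using 1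
      ext x
      simp [F, hl]
  have hSmem : ∀ l i, (fun x => S (l / 2) i (cl x)) ∈ affineCombinations (F l) := fun l i => by
    by_cases hl : l = 0
    · subst hl
      simp only [S, Nat.zero_div, Finset.range_zero, Finset.sum_empty]
      exact const_mem_affineCombinations _ 0
    · convert Submodule.sub_mem _ (coord_mem_affineCombinations (F l) (Sum.inr (Sum.inl i)))
        (const_mem_affineCombinations (F l) C) using 1
      ext x
      simp [F, hl]
  have hodd : ∀ l, l % 2 = 1 → ∀ i,
      (fun x => ψ (l / 2) i (cl x)) ∈ affineCombinations (F l) := fun l hl i => by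
    have hle : Submodule.span ℝ (range fun k v => max (G (l / 2) k v) 0)
        ≤ (affineCombinations (F l)).comap (LinearMap.funLeft ℝ ℝ cl) := by
      refine Submodule.span_le.2 ?_
      rintro f ⟨k, rfl⟩
      change (fun x => max (G (l / 2) k (cl x)) 0) ∈ affineCombinations (F l)
      have h := hneuron l k
      simpa [F, show l ≠ 0 by omega, hl] using h
    exact hle (hψ (l / 2) i)
  have heven : ∀ l, l % 2 = 0 → ∀ g ∈ reluSpan (ξ (l / 2)),
      (fun x => g (cl x)) ∈ affineCombinations (F l) := fun l hl g hg => by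
    have hle : reluSpan (ξ (l / 2))
        ≤ (affineCombinations (F l)).comap (LinearMap.funLeft ℝ ℝ cl) := by
      refine Submodule.span_le.2 ?_
      rintro f (rfl | rfl | ⟨k, rfl⟩)
      · exact one_mem_affineCombinations _
      · exact hclmem l
      · change (fun x => max (cl x - ξ (l / 2) k) 0) ∈ affineCombinations (F l)
        by_cases hl0 : l = 0
        · subst hl0
          by_cases hk : ξ 0 k ≤ hi
          · have := Submodule.sub_mem _ (hneuron 0 k)
              (coord_mem_affineCombinations (F 0) (Sum.inr (Sum.inl ⟨0, hd⟩)))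
            convert this using 1
            ext x
            have hx := max_clamp_sub hlohi (hξ 0 k) x
            rw [if_pos hk] at hx
            simpa [F] using hx
          · convert const_mem_affineCombinations (F 0) 0 using 1
            ext x
            have hx := max_clamp_sub hlohi (hξ 0 k) x
            rw [if_neg hk] at hx
            exact hx
        · have h := hneuron l k
          simpa [F, hl0, hl] using h
    exact hle hg
  have hSsucc : ∀ l, l % 2 = 1 → ∀ i,
      (fun x => S (l / 2 + 1) i (cl x)) ∈ affineCombinations (F l) := fun l hl i => by
    convert Submodule.add_mem _ (hSmem l i) (hodd l hl i) using 1
    ext x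
    simp [S, Finset.sum_range_succ]
  have hSnext : ∀ l i,
      (fun x => S ((l + 1) / 2) i (cl x)) ∈ affineCombinations (F l) := fun l i => by
    rcases Nat.mod_two_eq_zero_or_one l with hl | hl
    · rw [show (l + 1) / 2 = l / 2 by omega]
      exact hSmem l i
    · rw [show (l + 1) / 2 = l / 2 + 1 by omega]
      exact hSsucc l hl i
  have hcard : Fintype.card (Fin n ⊕ Fin d ⊕ Unit) = n + d + 1 := by simp [add_assoc]
  refine mem_NNset_of_layers hcard (L' := 2 * K - 1) (by omega) F ?_ ?_ φ ?_
  · rintro (k | i | u)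
    · exact ⟨1, -ξ 0 k, fun x => by simp [F, sub_eq_add_neg]⟩
    · exact ⟨1, -hi, fun x => by simp [F, sub_eq_add_neg]⟩
    · exact ⟨1, -lo, fun x => by simp [F, sub_eq_add_neg]⟩
  · rintro l hl (k | i | u)
    · rcases Nat.mod_two_eq_zero_or_one l with hl2 | hl2
      · exact ⟨_, heven l hl2 _ (hG (l / 2) k), fun x => by
          simp [F, show (l + 1) % 2 = 1 by omega, show (l + 1) / 2 = l / 2 by omega]⟩
      · exact ⟨_, Submodule.sub_mem _ (hclmem l)
          (const_mem_affineCombinations _ (ξ ((l + 1) / 2) k)), fun x => by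
          simp [F, show (l + 1) % 2 = 0 by omega]⟩
    · refine ⟨_, Submodule.add_mem _ (hSnext l i) (const_mem_affineCombinations _ C),
        fun x => ?_⟩
      have := hC ((l + 1) / 2) (by omega) i (cl x) (hcl x)
      simp [F, this]
    · refine ⟨_, Submodule.sub_mem _ (hclmem l) (const_mem_affineCombinations _ lo),
        fun x => ?_⟩
      have := (hcl x).1
      simp [F, this]
  · intro i
    have hlast := hSsucc (2 * K - 1) (by omega) i
    rw [show (2 * K - 1) / 2 + 1 = K by omega] at hlast
    convert Submodule.add_mem _ (Submodule.add_mem _ (const_mem_affineCombinations _ (α i))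
      (Submodule.smul_mem _ (β i) (hclmem _))) hlast using 1
    ext x
    simp [hφ, S, cl]

/-! ### Piecewise linear functions as sums of hat functions -/

/-- A function that is affine between consecutive nodes agrees, up to an affine function, with a
combination of hat functions with prescribed left end points, which peak at every `q`-th node. -/
lemma exists_eq_affine_add_sum_hat {q m N : ℕ} (hq : 0 < q) (hN : N ≤ m * q) {z : ℕ → ℝ}
    (hz : StrictMono z) {f : ℝ → ℝ} (hf : ∀ k ≤ N, IsAffineOn f (z k) (z (k + 1))) :
    ∃ (α β : ℝ) (a : ℕ → ℝ), ∀ v ∈ Icc (z 0) (z (N + 1)),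
      f v = α + β * v + ∑ k ∈ Finset.range (m * q),
        a k * hat (z k) (z ((k / q + 1) * q)) (z ((k / q + 1) * q + 1)) v := by
  have hlt : ∀ k, k < (k / q + 1) * q := fun k => by
    have := Nat.lt_div_mul_add hq (a := k)
    rw [add_mul, one_mul]
    exact this
  let T : ℕ → ℝ → ℝ := fun k => hat (z k) (z ((k / q + 1) * q)) (z ((k / q + 1) * q + 1))
  have hT0 : ∀ k j, j ≤ k → T k (z j) = 0 := fun k j hjk =>
    hat_of_le_left (hz (hlt k)) (hz.monotone hjk)
  have hTpos : ∀ k, T k (z (k + 1)) ≠ 0 := fun k =>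
    (hat_pos (hz (hlt k)) (hz (Nat.lt_succ_self _)) (hz (Nat.lt_succ_self _))
      (hz (Nat.succ_lt_succ (hlt k)))).ne'
  have hTend : ∀ k < m * q, T k (z (m * q + 1)) = 0 := fun k hk =>
    hat_of_right_le (hz (Nat.lt_succ_self _)) (hz.monotone (Nat.succ_le_succ
      (Nat.mul_le_mul_right q (Nat.succ_le_of_lt (Nat.div_lt_of_lt_mul (by linarith))))))
  have hz0 : z 0 < z (N + 1) := hz (Nat.succ_pos N)
  let β := (f (z (N + 1)) - f (z 0)) / (z (N + 1) - z 0)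
  let α := f (z 0) - β * z 0
  have hα : f (z 0) = α + β * z 0 := by simp only [α]; ring
  have hβ : f (z (N + 1)) = α + β * z (N + 1) := by
    have : z (N + 1) - z 0 ≠ 0 := by linarith
    have h : β * (z (N + 1) - z 0) = f (z (N + 1)) - f (z 0) := div_mul_cancel₀ _ this
    simp only [α]
    linarith
  obtain ⟨a, ha⟩ := exists_triangular_solution (fun k j => T k (z (j + 1)))
    (fun k j hjk => hT0 k (j + 1) hjk) hTpos
    (fun j => f (z (j + 1)) - (α + β * z (j + 1))) (m * q)
  refine ⟨α, β, a, ?_⟩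
  let g : ℝ → ℝ := fun v => α + β * v + ∑ k ∈ Finset.range (m * q), a k * T k v
  have hnode : ∀ j ≤ N + 1, f (z j) = g (z j) := by
    intro j hj
    rcases j with _ | j
    · have : ∑ k ∈ Finset.range (m * q), a k * T k (z 0) = 0 :=
        Finset.sum_eq_zero fun k _ => by rw [hT0 k 0 (Nat.zero_le k), mul_zero]
      simp only [g, this, hα, add_zero]
    · rcases Nat.lt_or_ge j (m * q) with hj' | hj'
      · have := ha j hj'
        simp only [g]
        linarith
      · obtain rfl : j = m * q := by omega
        obtain rfl : N = m * q := by omega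
        have : ∑ k ∈ Finset.range (m * q), a k * T k (z (m * q + 1)) = 0 :=
          Finset.sum_eq_zero fun k hk => by rw [hTend k (Finset.mem_range.1 hk), mul_zero]
        simp only [g, this, hβ, add_zero]
  have hg : ∀ k, IsAffineOn g (z k) (z (k + 1)) := fun k =>
    (isAffineOn_affine α β _ _).add (IsAffineOn.sum fun i _ =>
      (isAffineOn_hat hz (hlt i) (Nat.lt_succ_self _) k).const_mul (a i))
  have hcover : ∀ k ≤ N + 1, EqOn f g (Icc (z 0) (z k)) := by
    intro k
    induction k with
    | zero =>
      intro _ v hv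
      rw [Icc_self] at hv
      rw [hv]
      exact hnode 0 (Nat.zero_le _)
    | succ k ih =>
      intro hk v hv
      rcases le_total v (z k) with h | h
      · exact ih (by omega) ⟨hv.1, h⟩
      · exact (hf k (by omega)).eqOn (hg k) (hz (Nat.lt_succ_self k)) (hnode k (by omega))
          (hnode (k + 1) hk) ⟨h, hv.2⟩
  exact hcover (N + 1) le_rfl

lemma exists_max_eq_sum_hat_nodes {z : ℕ → ℝ} (hz : StrictMono z) {q e : ℕ} (he : e < q)
    (n B N : ℕ) (h : ℕ → ℝ) (hh : ∀ j, 0 ≤ h j) (c : ℕ) :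
    ∃ g ∈ reluSpan (fun j : Fin n => z ((B + j + 1) * q)), ∀ v ∈ Icc (z 0) (z (N + 1)),
      max (g v) 0 = ∑ j ∈ Finset.range n with j % 3 = c,
        h j * hat (z ((B + j) * q + e)) (z ((B + j + 1) * q)) (z ((B + j + 1) * q + 1)) v := by
  let ξ : ℕ → ℝ := fun m => if m = 0 then z 0 - 1 else if m = 1 then z 0
    else if m < n + 2 then z ((B + m - 1) * q) else z ((B + m - 1) * q + (N + 1))
  have hξ1 : ξ 1 = z 0 := rfl
  have hξmid : ∀ j < n, ξ (j + 2) = z ((B + j + 1) * q) := fun j hj => by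
    simp [ξ, hj, show B + (j + 2) - 1 = B + j + 1 by omega]
  have hξend : ∀ j, n ≤ j → ξ (j + 2) = z ((B + j + 1) * q + (N + 1)) := fun j hj => by
    simp [ξ, hj.not_gt, show B + (j + 2) - 1 = B + j + 1 by omega]
  have hsucc : ∀ k, (k + 1) * q = k * q + q := fun k => Nat.succ_mul k q
  have hξge : ∀ j, z ((B + j + 1) * q) ≤ ξ (j + 2) := fun j => by
    rcases Nat.lt_or_ge j n with hj | hj
    · exact (hξmid j hj).ge
    · rw [hξend j hj]
      exact hz.monotone (Nat.le_add_right _ _)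
  have hξle : ∀ j < n, ξ (j + 1) ≤ z ((B + j) * q) := fun j hj => by
    rcases j with _ | j
    · rw [hξ1]
      exact hz.monotone (Nat.zero_le _)
    · rw [hξmid j (by omega), add_assoc]
  have hξ : StrictMono ξ := by
    refine strictMono_nat_of_lt_succ fun m => ?_
    rcases m with _ | _ | j
    · simp [ξ]
    · refine lt_of_lt_of_le (hz ?_) (hξge 0)
      rw [hsucc]
      omega
    · change ξ (j + 2) < ξ (j + 1 + 2)
      have := hsucc (B + j + 1)
      rcases Nat.lt_or_ge j n with hj | hj
      · rw [hξmid j hj]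
        refine lt_of_lt_of_le (hz ?_) (hξge (j + 1))
        rw [← add_assoc B j 1]
        omega
      · rw [hξend j hj, hξend (j + 1) (by omega)]
        refine hz ?_
        rw [← add_assoc B j 1]
        omega
  obtain ⟨g, hg, hgv⟩ := exists_max_eq_sum_hat (n := n) hξ
    (l := fun j => z ((B + j) * q + e)) (r := fun j => z ((B + j + 1) * q + 1))
    (fun j hj => (hξle j hj).trans (hz.monotone (Nat.le_add_right _ _)))
    (fun j hj => by
      rw [hξmid j hj]
      refine hz ?_
      rw [hsucc]
      omega)
    (fun j hj => by
      rw [hξmid j hj]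
      exact hz (Nat.lt_succ_self _))
    (fun j _ => by
      refine le_trans (hz.monotone ?_) (hξge (j + 1))
      rw [← add_assoc B j 1, hsucc (B + j + 1)]
      omega)
    h hh c
  refine ⟨g, ?_, fun v hv => ?_⟩
  · convert hg using 3 with j
    exact (hξmid j j.isLt).symm
  · have hend : z (N + 1) ≤ ξ (n + 2) := by
      rw [hξend n le_rfl]
      exact hz.monotone (Nat.le_add_left _ _)
    rw [hgv v ⟨hξ1 ▸ hv.1, hv.2.trans hend⟩]
    refine Finset.sum_congr rfl fun j hj => ?_
    rw [hξmid j (Finset.mem_range.1 (Finset.mem_filter.1 hj).1)]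

lemma sum_range_mul_eq {M : Type*} [AddCommMonoid M] (f : ℕ → M) (m q : ℕ) :
    ∑ k ∈ Finset.range (m * q), f k
      = ∑ t ∈ Finset.range m, ∑ e ∈ Finset.range q, f (t * q + e) := by
  induction m with
  | zero => simp
  | succ m ih => rw [Nat.succ_mul, Finset.sum_range_add, ih, Finset.sum_range_succ]

lemma sum_eq_sum_mod_three (n : ℕ) (a H : ℕ → ℝ) :
    ∑ j ∈ Finset.range n, a j * H j
      = ∑ c : Fin 3, (∑ j ∈ Finset.range n with j % 3 = (c : ℕ), max (a j) 0 * H j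
          - ∑ j ∈ Finset.range n with j % 3 = (c : ℕ), max (-a j) 0 * H j) := by
  simp only [← Finset.sum_sub_distrib, ← sub_mul, max_zero_sub_max_neg_zero_eq_self]
  rw [Fin.sum_univ_eq_sum_range
    (fun c => ∑ j ∈ Finset.range n with j % 3 = c, a j * H j) 3,
    Finset.sum_fiberwise_of_maps_to fun j _ => Finset.mem_range.2 (Nat.mod_lt j (by norm_num))]

/-- Extension of a finite strictly increasing sequence of nodes to an infinite one. -/
lemma exists_strictMono_extension {m : ℕ} {z : Fin (m + 1) → ℝ} (hz : StrictMono z) :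
    ∃ ζ : ℕ → ℝ, StrictMono ζ ∧ ∀ i : Fin (m + 1), ζ i = z i := by
  refine ⟨fun k => if h : k < m + 1 then z ⟨k, h⟩ else z (Fin.last m) + (k - m : ℝ),
    strictMono_nat_of_lt_succ fun k => ?_, fun i => dif_pos i.isLt⟩
  rcases lt_trichotomy k m with h | rfl | h
  · simp only [show k < m + 1 by omega, show k + 1 < m + 1 by omega, dif_pos]
    exact hz (Nat.lt_succ_self k)
  · simp [Fin.last]
  · simp only [show ¬ k < m + 1 by omega, show ¬ k + 1 < m + 1 by omega, dif_neg,
      not_false_eq_true]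
    push_cast
    linarith

/-- Lemma: representation of continuous piecewise linear functions by ReLU
networks. -/
theorem statement4 (d N W L : ℕ) (hd : 0 < d) (hW : 7 * d + 1 ≤ W) (hL : 2 ≤ L)
    (hN : N ≤ (W - d - 1) * ((W - d - 1) / (6 * d)) * (L / 2))
    (z : Fin (N + 2) → ℝ) (hz : StrictMono z) :
    ∀ φ ∈ SpaceS d N z,
      (fun x : EuclideanSpace ℝ (Fin 1) => φ (x 0)) ∈ NNset 1 d W L := by
  rintro φ ⟨-, hleft, hright, haff⟩
  obtain ⟨n, rfl⟩ : ∃ n, W = n + d + 1 := ⟨W - d - 1, by omega⟩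
  rw [show n + d + 1 - d - 1 = n by omega] at hN
  set q := n / (6 * d)
  set K := L / 2 with hKdef
  have hq : 0 < q := Nat.div_pos (by omega) (by omega)
  have hK : 0 < K := by omega
  have hcard : Fintype.card (Fin d × Fin q × Fin 3 × Bool) ≤ Fintype.card (Fin n) := by
    have := Nat.div_mul_le_self n (6 * d)
    simp only [Fintype.card_prod, Fintype.card_fin, Fintype.card_bool]
    calc d * (q * (3 * 2)) = q * (6 * d) := by ring
      _ ≤ n := this
  obtain ⟨emb⟩ := Function.Embedding.nonempty_of_card_le hcard
  obtain ⟨ζ, hζ, hζz⟩ := exists_strictMono_extension hz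
  have hζ0 : ζ 0 = z 0 := hζz 0
  have hζlast : ζ (N + 1) = z (Fin.last (N + 1)) := hζz (Fin.last (N + 1))
  have hlohi : ζ 0 ≤ ζ (N + 1) := hζ.monotone (Nat.zero_le _)
  have hpieces : ∀ i, ∀ k ≤ N, IsAffineOn (fun x => φ x i) (ζ k) (ζ (k + 1)) := by
    intro i k hk
    obtain ⟨a, b, hab⟩ := haff ⟨k, by omega⟩
    refine ⟨b i, a i, fun v hv => ?_⟩
    have h1 := hζz (Fin.castSucc ⟨k, by omega⟩)
    have h2 := hζz (Fin.succ ⟨k, by omega⟩)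
    simp only [Fin.val_castSucc, Fin.val_succ] at h1 h2
    rw [h1, h2] at hv
    simp only [hab v hv, PiLp.add_apply, PiLp.smul_apply, smul_eq_mul]
    ring
  choose α β a ha using fun i =>
    exists_eq_affine_add_sum_hat hq (m := K * n) (hN.trans (by rw [mul_right_comm, mul_comm n K]))
      hζ (hpieces i)
  choose g hg hgv using fun (s : ℕ) (t : Fin d × Fin q × Fin 3 × Bool) =>
    exists_max_eq_sum_hat_nodes hζ t.2.1.isLt n (s * n) N
      (fun j => max (bif t.2.2.2 then a t.1 ((s * n + j) * q + t.2.1)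
        else -a t.1 ((s * n + j) * q + t.2.1)) 0) (fun _ => le_max_right _ _) t.2.2.1
  have hclamp : ∀ x, φ x = φ (max (ζ 0) (min x (ζ (N + 1)))) := fun x => by
    rcases le_total x (ζ 0) with h | h
    · rw [max_eq_left (min_le_of_left_le h), hζ0]
      exact hleft x (hζ0 ▸ h)
    rcases le_total x (ζ (N + 1)) with h' | h'
    · rw [min_eq_left h', max_eq_right h]
    · rw [min_eq_right h', max_eq_right hlohi, hζlast]
      exact hright x (hζlast ▸ h')
  refine mem_NNset_of_sum hd hK (by omega) hlohi (fun s j => ζ ((s * n + j + 1) * q))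
    (fun s j => hζ.monotone (Nat.zero_le _))
    (fun s => Function.extend emb (g s) 0) (fun s k => ?_)
    (fun s i v => ∑ e : Fin q, ∑ c : Fin 3,
      (max (g s (i, e, c, true) v) 0 - max (g s (i, e, c, false) v) 0))
    (fun s i => ?_) α β φ fun x i => ?_
  · by_cases hk : ∃ t, emb t = k
    · obtain ⟨t, rfl⟩ := hk
      rw [emb.injective.extend_apply]
      exact hg s t
    · rw [Function.extend_apply' _ _ _ hk]
      exact Submodule.zero_mem _
  · have hmem : ∀ t, (fun v => max (g s t v) 0) ∈ Submodule.span ℝ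
        (range fun k v => max (Function.extend emb (g s) 0 k v) 0) := fun t =>
      Submodule.subset_span ⟨emb t, by simp only [emb.injective.extend_apply]⟩
    convert Submodule.sum_mem _ fun (e : Fin q) (_ : e ∈ Finset.univ) =>
      Submodule.sum_mem _ fun (c : Fin 3) (_ : c ∈ Finset.univ) =>
        Submodule.sub_mem _ (hmem (i, e, c, true)) (hmem (i, e, c, false)) using 1
    ext v
    simp
  · have hv : max (ζ 0) (min x (ζ (N + 1))) ∈ Icc (ζ 0) (ζ (N + 1)) :=
      ⟨le_max_left _ _, max_le hlohi (min_le_right _ _)⟩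
    rw [hclamp x]
    generalize max (ζ 0) (min x (ζ (N + 1))) = v at hv
    rw [ha i v hv, sum_range_mul_eq, sum_range_mul_eq]
    congr 1
    refine Finset.sum_congr rfl fun s _ => ?_
    simp only [hgv s _ v hv, cond_true, cond_false]
    rw [Finset.sum_comm, Finset.sum_range]
    refine Finset.sum_congr rfl fun e _ => ?_
    rw [← sum_eq_sum_mod_three n (fun j => a i ((s * n + j) * q + e))]
    refine Finset.sum_congr rfl fun j _ => ?_
    have hdiv : ((s * n + j) * q + e) / q = s * n + j := by
      rw [mul_comm, Nat.mul_add_div hq, Nat.div_eq_of_lt e.isLt, add_zero]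
    rw [hdiv]
end

section
/- Let $W, L \ge 2$, $N \in \mathbb{N}$, and $z_0 < z_1 < \dots < z_N < z_{N+1}$ be real numbers. If $\mathcal{S}^d(z_0,\dots,z_{N+1}) \subseteq \mathcal{NN}(W,L)$, then $d(N+2) \le n(W,L)$, where $n(W,L) = (L-1)W^2 + (L+d+1)W + d$ is the number of parameters of a ReLU network of width $W$ and depth $L$ with one-dimensional input and $d$-dimensional output. Consequently, $N = O(W^2 L / d)$. -/
open MeasureTheory Filter Topology Metric Set
open scoped ENNReal NNReal

/-- The set `S` is covered by the image of `ℝ^m` under a locally Lipschitz map. -/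
def IsLipschitzParametrized {E : Type*} [PseudoEMetricSpace E] (m : ℕ) (S : Set E) : Prop :=
  ∃ f : (Fin m → ℝ) → E, LocallyLipschitz f ∧ S ⊆ range f

namespace IsLipschitzParametrized

variable {E F : Type*}

lemma mono [PseudoEMetricSpace E] {m : ℕ} {S T : Set E} (hS : IsLipschitzParametrized m S)
    (h : T ⊆ S) : IsLipschitzParametrized m T := by
  obtain ⟨f, hf, hSf⟩ := hS
  exact ⟨f, hf, h.trans hSf⟩

lemma image [PseudoEMetricSpace E] [PseudoEMetricSpace F] {m : ℕ} {S : Set E}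
    (hS : IsLipschitzParametrized m S) {g : E → F} (hg : LocallyLipschitz g) :
    IsLipschitzParametrized m (g '' S) := by
  obtain ⟨f, hf, hSf⟩ := hS
  refine ⟨g ∘ f, hg.comp hf, ?_⟩
  rw [range_comp]
  exact image_mono hSf

lemma singleton [PseudoEMetricSpace E] (x : E) : IsLipschitzParametrized 0 {x} :=
  ⟨fun _ => x, LocallyLipschitz.const x, by simp⟩

/-- The product of a parametrized set with a finite-dimensional space. -/
lemma prod_univ [PseudoEMetricSpace E] {m : ℕ} {S : Set E}
    (hS : IsLipschitzParametrized m S) (P : Type*) [NormedAddCommGroup P] [NormedSpace ℝ P]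
    [FiniteDimensional ℝ P] :
    IsLipschitzParametrized (m + Module.finrank ℝ P) (S ×ˢ (univ : Set P)) := by
  obtain ⟨f, hf, hSf⟩ := hS
  let e : (Fin (m + Module.finrank ℝ P) → ℝ) ≃L[ℝ] (Fin m → ℝ) × P :=
    ContinuousLinearEquiv.ofFinrankEq (by simp)
  refine ⟨fun θ => (f (e θ).1, (e θ).2), ?_, ?_⟩
  · have he : LocallyLipschitz e := e.lipschitz.locallyLipschitz
    exact (hf.comp (LipschitzWith.prod_fst.locallyLipschitz.comp he)).prodMk
      (LipschitzWith.prod_snd.locallyLipschitz.comp he)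
  · rintro ⟨x, p⟩ ⟨hx, -⟩
    obtain ⟨η, rfl⟩ := hSf hx
    exact ⟨e.symm (η, p), by simp⟩

lemma dimH_le [EMetricSpace E] {m : ℕ} {S : Set E} (hS : IsLipschitzParametrized m S) :
    dimH S ≤ m := by
  obtain ⟨f, hf, hSf⟩ := hS
  calc dimH S ≤ dimH (range f) := dimH_mono hSf
    _ ≤ dimH (univ : Set (Fin m → ℝ)) := dimH_range_le_of_locally_lipschitzOn hf
    _ = m := by rw [Real.dimH_univ_eq_finrank]; simp

/-- Applying all affine maps `ℝ^n → ℝ^p` to a parametrized family of `K`-tuples of points. -/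
lemma affine {K m n : ℕ} {S : Set (Fin K → Fin n → ℝ)} (hS : IsLipschitzParametrized m S)
    (p : ℕ) :
    IsLipschitzParametrized (m + p * (n + 1))
      {Y : Fin K → Fin p → ℝ | ∃ X ∈ S, ∃ (A : Matrix (Fin p) (Fin n) ℝ) (c : Fin p → ℝ),
        ∀ k, Y k = A.mulVec (X k) + c} := by
  have h := hS.prod_univ ((Fin p → Fin n → ℝ) × (Fin p → ℝ))
  have hdim : Module.finrank ℝ ((Fin p → Fin n → ℝ) × (Fin p → ℝ)) = p * (n + 1) := by
    simp [Module.finrank_pi_fintype, mul_add]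
  rw [hdim] at h
  let g : (Fin K → Fin n → ℝ) × ((Fin p → Fin n → ℝ) × (Fin p → ℝ)) → Fin K → Fin p → ℝ :=
    fun q k i => ∑ j, q.2.1 i j * q.1 k j + q.2.2 i
  have hg : ContDiff ℝ 1 g := by
    unfold g
    fun_prop
  refine (h.image hg.locallyLipschitz).mono ?_
  rintro Y ⟨X, hX, A, c, hY⟩
  refine ⟨(X, (A, c)), ⟨hX, mem_univ _⟩, ?_⟩
  funext k i
  simp [g, hY, Matrix.mulVec, dotProduct]

end IsLipschitzParametrized

/-- Extension of a vector by zeros (truncating it when `w < n`). -/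
def zeroPad {n : ℕ} (w : ℕ) (y : Fin n → ℝ) : Fin w → ℝ :=
  fun j => if h : (j : ℕ) < n then y ⟨j, h⟩ else 0

lemma zeroPad_mulVec_add {n p w v : ℕ} (hn : n ≤ w) (A : Matrix (Fin p) (Fin n) ℝ)
    (y : Fin n → ℝ) (c : Fin p → ℝ) :
    zeroPad v (A.mulVec y + c) =
      Matrix.mulVec (fun i j => zeroPad v (fun i' => zeroPad w (A i') j) i) (zeroPad w y) +
        zeroPad v c := by
  obtain ⟨r, rfl⟩ := Nat.exists_eq_add_of_le hn
  funext i
  by_cases hi : (i : ℕ) < p <;>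
    simp [zeroPad, hi, Matrix.mulVec, dotProduct, Fin.sum_univ_add]

lemma zeroPad_self {n : ℕ} (y : Fin n → ℝ) : zeroPad n y = y := by
  funext i
  simp [zeroPad]

lemma locallyLipschitz_relu (K p : ℕ) :
    LocallyLipschitz (fun (Y : Fin K → Fin p → ℝ) k i => max (Y k i) 0) := by
  refine LipschitzWith.locallyLipschitz (K := 1) (LipschitzWith.of_dist_le_mul fun X Y => ?_)
  rw [NNReal.coe_one, one_mul]
  refine (dist_pi_le_iff dist_nonneg).2 fun k => (dist_pi_le_iff dist_nonneg).2 fun i => ?_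
  calc dist (max (X k i) 0) (max (Y k i) 0) ≤ dist (X k i) (Y k i) := by
        simpa [Real.dist_eq] using abs_max_sub_max_le_abs (X k i) (Y k i) 0
    _ ≤ dist X Y := (dist_le_pi_dist (X k) (Y k) i).trans (dist_le_pi_dist X Y k)

/-- The zero-padded values of the `l`-th layer at `K` fixed points, over all networks whose layer
sizes are bounded by `w`. -/
def layerValues {K : ℕ} (w : ℕ → ℕ) (x : Fin K → Fin (w 0) → ℝ) (l : ℕ) :
    Set (Fin K → Fin (w l) → ℝ) :=
  {Y | ∃ (N : ℕ → ℕ) (M : ∀ l : ℕ, Matrix (Fin (N (l + 1))) (Fin (N l)) ℝ)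
      (b : ∀ l : ℕ, Fin (N (l + 1)) → ℝ) (X : Fin K → Fin (N 0) → ℝ),
      (∀ j ≤ l, N j ≤ w j) ∧ (∀ k, zeroPad (w 0) (X k) = x k) ∧
        ∀ k, Y k = zeroPad (w l) (nnForward N M b l (X k))}

lemma isLipschitzParametrized_layerValues {K : ℕ} (w : ℕ → ℕ) (x : Fin K → Fin (w 0) → ℝ)
    (l : ℕ) :
    IsLipschitzParametrized (∑ j ∈ Finset.range l, w (j + 1) * (w j + 1))
      (layerValues w x l) := by
  induction l with
  | zero =>
    refine (IsLipschitzParametrized.singleton x).mono ?_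
    rintro Y ⟨N, M, b, X, -, hX, hY⟩
    funext k
    rw [hY, ← hX]
    rfl
  | succ l ih =>
    rw [Finset.sum_range_succ]
    refine ((ih.affine (w (l + 1))).image (locallyLipschitz_relu K _)).mono ?_
    rintro Y ⟨N, M, b, X, hN, hX, hY⟩
    refine ⟨fun k => zeroPad (w (l + 1)) ((M l).mulVec (nnForward N M b l (X k)) + b l),
      ⟨fun k => zeroPad (w l) (nnForward N M b l (X k)),
        ⟨N, M, b, X, fun j hj => hN j (hj.trans l.le_succ), hX, fun _ => rfl⟩, _, _,
        fun k => zeroPad_mulVec_add (hN l l.le_succ) _ _ _⟩, ?_⟩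
    funext k i
    rw [hY]
    by_cases hi : (i : ℕ) < N (l + 1) <;> simp [zeroPad, hi, nnForward]

/-- The values at `K` fixed real points of all `d`-dimensional ReLU networks of width at most `W`
with exactly `L` hidden layers are covered by a locally Lipschitz image of the parameter space. -/
lemma isLipschitzParametrized_outputs {K : ℕ} (d W L : ℕ) (hL : 1 ≤ L) (x : Fin K → ℝ) :
    IsLipschitzParametrized ((L - 1) * W ^ 2 + (L + d + 1) * W + d)
      {Y : Fin K → Fin d → ℝ | ∃ (N : ℕ → ℕ) (_ : N 0 = 1) (hd : N (L + 1) = d),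
        (∀ l, 1 ≤ l → l ≤ L → N l ≤ W) ∧
        ∃ (M : ∀ l : ℕ, Matrix (Fin (N (l + 1))) (Fin (N l)) ℝ)
          (b : ∀ l : ℕ, Fin (N (l + 1)) → ℝ), ∀ k i,
          Y k i = (M L).mulVec (nnForward N M b L (fun _ => x k)) (Fin.cast hd.symm i) +
            b L (Fin.cast hd.symm i)} := by
  let w : ℕ → ℕ := fun l => if l = 0 then 1 else W
  have hcount : ∑ j ∈ Finset.range L, w (j + 1) * (w j + 1) + d * (w L + 1) =
      (L - 1) * W ^ 2 + (L + d + 1) * W + d := by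
    obtain ⟨n, rfl⟩ := Nat.exists_eq_add_of_le' hL
    rw [Finset.sum_range_succ']
    simp [w]
    ring
  rw [← hcount]
  refine ((isLipschitzParametrized_layerValues w (fun k _ => x k) L).affine d).mono ?_
  rintro Y ⟨N, h0, hd, hN, M, b, hY⟩
  have hNw : ∀ j ≤ L, N j ≤ w j := by
    intro j hj
    rcases Nat.eq_zero_or_pos j with rfl | h
    · simp [w, h0]
    · simpa [w, h.ne'] using hN j h hj
  refine ⟨fun k => zeroPad (w L) (nnForward N M b L (fun _ => x k)),
    ⟨N, M, b, fun k _ => x k, hNw, ?_, fun _ => rfl⟩,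
    fun i j => zeroPad d (fun i' => zeroPad (w L) (M L i') j) i, zeroPad d (b L), fun k => ?_⟩
  · intro k
    funext i
    have hi : (i : ℕ) < N 0 := by rw [h0]; exact i.2
    simp only [zeroPad, hi, dite_true]
  · rw [← zeroPad_mulVec_add (hNw L le_rfl)]
    funext i
    have hi : (i : ℕ) < N (L + 1) := by rw [hd]; exact i.2
    simp only [zeroPad, hi, dite_true, hY, Pi.add_apply]
    rfl

/-- The affine ramp increasing from `0` at `a` to `1` at `b`, constant outside `[a, b]`. -/
noncomputable def ramp (a b x : ℝ) : ℝ := max 0 (min 1 ((x - a) / (b - a)))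

lemma ramp_of_le_left {a b x : ℝ} (hab : a < b) (hx : x ≤ a) : ramp a b x = 0 := by
  have : (x - a) / (b - a) ≤ 0 := div_nonpos_of_nonpos_of_nonneg (by linarith) (by linarith)
  exact max_eq_left ((min_le_right _ _).trans this)

lemma ramp_of_right_le {a b x : ℝ} (hab : a < b) (hx : b ≤ x) : ramp a b x = 1 := by
  have : 1 ≤ (x - a) / (b - a) := by
    rw [one_le_div (by linarith)]
    linarith
  simp [ramp, min_eq_left this]

lemma ramp_of_mem {a b x : ℝ} (hab : a < b) (hx : x ∈ Icc a b) :
    ramp a b x = (x - a) / (b - a) := by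
  have h0 : 0 ≤ (x - a) / (b - a) := div_nonneg (by linarith [hx.1]) (by linarith)
  have h1 : (x - a) / (b - a) ≤ 1 := by
    rw [div_le_one (by linarith)]
    linarith [hx.2]
  rw [ramp, min_eq_right h1, max_eq_right h0]

lemma continuous_ramp (a b : ℝ) : Continuous (ramp a b) := by
  unfold ramp
  fun_prop

/-- Every value assignment at the breakpoints is interpolated by an element of `SpaceS`. -/
lemma exists_mem_SpaceS_eq {d N : ℕ} {z : Fin (N + 2) → ℝ} (hz : StrictMono z)
    (v : Fin (N + 2) → EuclideanSpace ℝ (Fin d)) :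
    ∃ φ ∈ SpaceS d N z, ∀ k, φ (z k) = v k := by
  have hlt : ∀ i : Fin (N + 1), z i.castSucc < z i.succ := fun i => hz i.castSucc_lt_succ
  let φ : ℝ → EuclideanSpace ℝ (Fin d) := fun x =>
    v 0 + ∑ i : Fin (N + 1), ramp (z i.castSucc) (z i.succ) x • (v i.succ - v i.castSucc)
  refine ⟨φ, ⟨?_, ?_, ?_, ?_⟩, ?_⟩
  · have := fun i : Fin (N + 1) => continuous_ramp (z i.castSucc) (z i.succ)
    fun_prop
  · intro x hx
    simp only [φ]
    congr 1
    refine Finset.sum_congr rfl fun i _ => ?_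
    have hi : z 0 ≤ z i.castSucc := hz.monotone (Fin.zero_le _)
    rw [ramp_of_le_left (hlt i) (hx.trans hi), ramp_of_le_left (hlt i) hi]
  · intro x hx
    simp only [φ]
    congr 1
    refine Finset.sum_congr rfl fun i _ => ?_
    have hi : z i.succ ≤ z (Fin.last (N + 1)) := hz.monotone (Fin.le_last _)
    rw [ramp_of_right_le (hlt i) (hi.trans hx), ramp_of_right_le (hlt i) hi]
  · intro k
    have hterm : ∀ i : Fin (N + 1), ∃ a b : EuclideanSpace ℝ (Fin d),
        ∀ x ∈ Icc (z k.castSucc) (z k.succ),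
          ramp (z i.castSucc) (z i.succ) x • (v i.succ - v i.castSucc) = x • a + b := by
      intro i
      rcases lt_trichotomy i k with h | rfl | h
      · refine ⟨0, v i.succ - v i.castSucc, fun x hx => ?_⟩
        have : z i.succ ≤ z k.castSucc := hz.monotone (Fin.succ_le_castSucc_iff.2 h)
        simp [ramp_of_right_le (hlt i) (this.trans hx.1)]
      · refine ⟨(z i.succ - z i.castSucc)⁻¹ • (v i.succ - v i.castSucc),
          -(z i.castSucc / (z i.succ - z i.castSucc)) • (v i.succ - v i.castSucc),
          fun x hx => ?_⟩
        rw [ramp_of_mem (hlt i) hx, smul_smul, ← add_smul]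
        congr 1
        ring
      · refine ⟨0, 0, fun x hx => ?_⟩
        have : z k.succ ≤ z i.castSucc := hz.monotone (Fin.succ_le_castSucc_iff.2 h)
        simp [ramp_of_le_left (hlt i) (hx.2.trans this)]
    choose a b hab using hterm
    refine ⟨∑ i, a i, v 0 + ∑ i, b i, fun x hx => ?_⟩
    simp only [φ, Finset.sum_congr rfl fun i _ => hab i x hx, Finset.sum_add_distrib,
      Finset.smul_sum]
    abel
  · intro k
    induction k using Fin.induction with
    | zero =>
      have : ∀ i : Fin (N + 1), ramp (z i.castSucc) (z i.succ) (z 0) = 0 :=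
        fun i => ramp_of_le_left (hlt i) (hz.monotone (Fin.zero_le _))
      simp [φ, this]
    | succ k ih =>
      have hdiff : φ (z k.succ) - φ (z k.castSucc) = v k.succ - v k.castSucc := by
        simp only [φ, add_sub_add_left_eq_sub, ← Finset.sum_sub_distrib, ← sub_smul]
        rw [Finset.sum_eq_single k]
        · rw [ramp_of_right_le (hlt k) le_rfl, ramp_of_le_left (hlt k) le_rfl]
          simp
        · intro i _ hik
          rcases lt_or_gt_of_ne hik with h | h
          · have hi : z i.succ ≤ z k.castSucc := hz.monotone (Fin.succ_le_castSucc_iff.2 h)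
            rw [ramp_of_right_le (hlt i) (hi.trans (hlt k).le), ramp_of_right_le (hlt i) hi]
            simp
          · have hi : z k.succ ≤ z i.castSucc := hz.monotone (Fin.succ_le_castSucc_iff.2 h)
            rw [ramp_of_le_left (hlt i) hi, ramp_of_le_left (hlt i) ((hlt k).le.trans hi)]
            simp
        · simp
      rw [ih] at hdiff
      exact sub_left_injective hdiff

/-- Remark: the construction is asymptotically optimal, by a parameter-counting
/ Hausdorff-dimension argument. -/
theorem statement5 (d N W L : ℕ) (hW : 2 ≤ W) (hL : 2 ≤ L)
    (z : Fin (N + 2) → ℝ) (hz : StrictMono z)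
    (h : ∀ φ ∈ SpaceS d N z,
      (fun x : EuclideanSpace ℝ (Fin 1) => φ (x 0)) ∈ NNset 1 d W L) :
    d * (N + 2) ≤ (L - 1) * W ^ 2 + (L + d + 1) * W + d ∧
      d * N ≤ 2 * W ^ 2 * L + d * W := by
  have key : d * (N + 2) ≤ (L - 1) * W ^ 2 + (L + d + 1) * W + d := by
    let S : ℕ → Set (Fin (N + 2) → Fin d → ℝ) := fun L' =>
      {Y | ∃ (n : ℕ → ℕ) (_ : n 0 = 1) (hd : n (L' + 1) = d),
        (∀ l, 1 ≤ l → l ≤ L' → n l ≤ W) ∧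
        ∃ (M : ∀ l : ℕ, Matrix (Fin (n (l + 1))) (Fin (n l)) ℝ)
          (b : ∀ l : ℕ, Fin (n (l + 1)) → ℝ), ∀ k i,
          Y k i = (M L').mulVec (nnForward n M b L' (fun _ => z k)) (Fin.cast hd.symm i) +
            b L' (Fin.cast hd.symm i)}
    have hcover : (univ : Set (Fin (N + 2) → Fin d → ℝ)) ⊆ ⋃ L' ∈ Icc 1 L, S L' := by
      intro Y _
      obtain ⟨φ, hφ, hφY⟩ := exists_mem_SpaceS_eq hz (fun k => WithLp.toLp 2 (Y k))
      obtain ⟨L', h1, hL', n, h0, hd, hn, M, b, heq⟩ := h φ hφ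
      refine mem_biUnion (⟨h1, hL'⟩ : L' ∈ Icc 1 L) ⟨n, h0, hd, hn, M, b, fun k i => ?_⟩
      simpa [hφY] using heq (WithLp.toLp 2 fun _ => z k) i
    have hdim : dimH (univ : Set (Fin (N + 2) → Fin d → ℝ)) ≤
        ((L - 1) * W ^ 2 + (L + d + 1) * W + d : ℕ) := by
      refine (dimH_mono hcover).trans ?_
      rw [dimH_bUnion (to_countable _)]
      refine iSup₂_le fun L' hL' => ?_
      refine (isLipschitzParametrized_outputs d W L' hL'.1 z).dimH_le.trans ?_
      have hle : L' ≤ L := hL'.2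
      exact_mod_cast (by gcongr :
        (L' - 1) * W ^ 2 + (L' + d + 1) * W + d ≤ (L - 1) * W ^ 2 + (L + d + 1) * W + d)
    rw [Real.dimH_univ_eq_finrank] at hdim
    have hfin : Module.finrank ℝ (Fin (N + 2) → Fin d → ℝ) = (N + 2) * d := by
      simp [Module.finrank_pi_fintype]
    rw [hfin] at hdim
    rw [mul_comm]
    exact_mod_cast hdim
  refine ⟨key, ?_⟩
  obtain ⟨n, rfl⟩ := Nat.exists_eq_add_of_le' hL
  rw [show n + 2 - 1 = n + 1 by omega] at key
  nlinarith [Nat.mul_le_mul_right ((n + 3) * W) hW]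
end

section
/- Suppose $W \ge 7d+1$, $L \ge 2$ and $p \in [1,\infty)$. Let $\nu$ be an absolutely continuous probability distribution on $\mathbb{R}$. If $n \le \frac{W-d-1}{2} \lfloor \frac{W-d-1}{6d} \rfloor \lfloor \frac{L}{2} \rfloor + 2$, then for any discrete probability measure $\mu$ on $\mathbb{R}^d$ supported on at most $n$ points, $\inf_{\phi \in \mathcal{NN}(W,L)} W_p(\mu, \phi_\# \nu) = 0$. -/
open MeasureTheory Filter Topology Metric Set
open scoped ENNReal NNReal

section FeatureSpaces

/-- The number of neurons in layer `l` of a network with scalar input and hidden width `W`. -/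
def layerWidth (W l : ℕ) : ℕ := if l = 0 then 1 else W

/-- Forward pass of a scalar-input network of hidden width `W`, with weights and neurons indexed
by natural numbers. -/
noncomputable def scalarForward (W : ℕ) (A : ℕ → ℕ → ℕ → ℝ) (c : ℕ → ℕ → ℝ) : ℕ → ℝ → ℕ → ℝ
  | 0, x, _ => x
  | l + 1, x, i =>
    max (∑ j ∈ Finset.range (layerWidth W l), A l i j * scalarForward W A c l x j + c l i) 0

/-- `IsFeatureSpace W l V` says that `V` consists of the affine combinations of the neurons in the
`l`-th layer of some ReLU network of width `W` with scalar input. -/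
inductive IsFeatureSpace (W : ℕ) : ℕ → Submodule ℝ (ℝ → ℝ) → Prop
  | input : IsFeatureSpace W 0 (Submodule.span ℝ {fun _ => 1, fun x => x})
  | layer {l : ℕ} {V : Submodule ℝ (ℝ → ℝ)} (hV : IsFeatureSpace W l V) (g : Fin W → ℝ → ℝ)
      (hg : ∀ i, g i ∈ V) :
      IsFeatureSpace W (l + 1)
        (Submodule.span ℝ (insert (fun _ => 1) (range fun i x => max (g i x) 0)))

theorem scalarForward_congr {W k : ℕ} {A A' : ℕ → ℕ → ℕ → ℝ} {c c' : ℕ → ℕ → ℝ}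
    (hA : ∀ l < k, A l = A' l) (hc : ∀ l < k, c l = c' l) :
    scalarForward W A c k = scalarForward W A' c' k := by
  induction k with
  | zero => rfl
  | succ k ih =>
    have := ih (fun l hl => hA l (by omega)) (fun l hl => hc l (by omega))
    ext x i
    simp only [scalarForward, this, hA k (by omega), hc k (by omega)]

namespace IsFeatureSpace

variable {W l : ℕ} {V : Submodule ℝ (ℝ → ℝ)}

theorem const_mem (hV : IsFeatureSpace W l V) (a : ℝ) : (fun _ => a) ∈ V := by
  have h1 : (fun _ : ℝ => (1 : ℝ)) ∈ V := by
    cases hV <;> exact Submodule.subset_span (by simp)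
  convert V.smul_mem a h1 using 1
  ext; simp

theorem measurable (hV : IsFeatureSpace W l V) : ∀ f ∈ V, Measurable f := by
  induction hV with
  | input =>
    intro f hf
    induction hf using Submodule.span_induction with
    | mem f hf => rcases hf with rfl | rfl <;> fun_prop
    | zero => exact measurable_const
    | add f g _ _ hf hg => exact hf.add hg
    | smul a f _ hf => exact hf.const_smul a
  | layer hV g hg ih =>
    intro f hf
    induction hf using Submodule.span_induction with
    | mem f hf =>
      rcases hf with rfl | ⟨i, rfl⟩
      · fun_prop
      · exact (ih _ (hg i)).max measurable_const
    | zero => exact measurable_const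
    | add f g _ _ hf hg => exact hf.add hg
    | smul a f _ hf => exact hf.const_smul a

theorem exists_succ (hV : IsFeatureSpace W l V) {ι : Type} [Fintype ι]
    (hι : Fintype.card ι ≤ W) (g : ι → ℝ → ℝ) (hg : ∀ i, g i ∈ V) :
    ∃ V', IsFeatureSpace W (l + 1) V' ∧ ∀ i, (fun x => max (g i x) 0) ∈ V' := by
  obtain ⟨e⟩ : Nonempty (ι ↪ Fin W) :=
    Function.Embedding.nonempty_of_card_le (by simpa using hι)
  refine ⟨_, hV.layer (Function.extend e g 0) fun i => ?_, fun i => ?_⟩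
  · by_cases h : ∃ a, e a = i
    · obtain ⟨a, rfl⟩ := h
      rw [e.injective.extend_apply]
      exact hg a
    · rw [Function.extend_apply' _ _ _ h]
      exact V.zero_mem
  · refine Submodule.subset_span (Or.inr ⟨e i, ?_⟩)
    simp only [e.injective.extend_apply]

theorem exists_scalarForward (hV : IsFeatureSpace W l V) :
    ∃ (A : ℕ → ℕ → ℕ → ℝ) (c : ℕ → ℕ → ℝ), ∀ f ∈ V, ∃ (a : ℕ → ℝ) (a₀ : ℝ), ∀ x,
      f x = ∑ j ∈ Finset.range (layerWidth W l), a j * scalarForward W A c l x j + a₀ := by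
  induction hV with
  | input =>
    refine ⟨0, 0, fun f hf => ?_⟩
    obtain ⟨a₀, a, rfl⟩ := Submodule.mem_span_pair.1 hf
    refine ⟨fun _ => a, a₀, fun x => ?_⟩
    simp [layerWidth, scalarForward, add_comm]
  | @layer l V hV g hg ih =>
    obtain ⟨A, c, hAc⟩ := ih
    choose a a₀ ha using fun i => hAc (g i) (hg i)
    refine ⟨Function.update A l fun i j => if h : i < W then a ⟨i, h⟩ j else 0,
      Function.update c l fun i => if h : i < W then a₀ ⟨i, h⟩ else 0, fun f hf => ?_⟩
    obtain ⟨b₀, z, hz, rfl⟩ := Submodule.mem_span_insert.1 hf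
    obtain ⟨b, rfl⟩ := (Submodule.mem_span_range_iff_exists_fun ℝ).1 hz
    refine ⟨fun j => if h : j < W then b ⟨j, h⟩ else 0, b₀, fun x => ?_⟩
    have hcongr : scalarForward W (Function.update A l fun i j => if h : i < W then a ⟨i, h⟩ j else 0)
        (Function.update c l fun i => if h : i < W then a₀ ⟨i, h⟩ else 0) l
        = scalarForward W A c l :=
      scalarForward_congr (fun k hk => by rw [Function.update_of_ne hk.ne])
        (fun k hk => by rw [Function.update_of_ne hk.ne])
    simp only [layerWidth, Nat.add_eq_zero_iff, one_ne_zero, and_false, if_false]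
    rw [← Fin.sum_univ_eq_sum_range (fun j => (if h : j < W then b ⟨j, h⟩ else 0) *
      scalarForward W _ _ (l + 1) x j) W]
    simp only [scalarForward, hcongr, Function.update_self, Fin.is_lt, dif_pos, Fin.eta, ← ha]
    simp [add_comm]

theorem mem_NNset1 (hV : IsFeatureSpace W l V) (hl : 1 ≤ l) {d L : ℕ} (hlL : l ≤ L)
    (φ : ℝ → EuclideanSpace ℝ (Fin d)) (hφ : ∀ i, (fun x => φ x i) ∈ V) :
    φ ∈ NNset1 d W L := by
  obtain ⟨A, c, hAc⟩ := hV.exists_scalarForward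
  choose a a₀ ha using fun i => hAc _ (hφ i)
  set N : ℕ → ℕ := fun k => if k = 0 then 1 else if k ≤ l then W else d with hN
  have hNk : ∀ k ≤ l, N k = layerWidth W k := fun k hk => by simp [hN, layerWidth, hk]
  have hNl : N (l + 1) = d := by simp [hN]
  have hN0 : N 0 = 1 := by simp [hN]
  refine ⟨l, hl, hlL, N, hN0, hNl, fun k hk hkl => ?_,
    fun k i j => if k < l then A k i j else if h : (i : ℕ) < d then a ⟨i, h⟩ j else 0,
    fun k i => if k < l then c k i else if h : (i : ℕ) < d then a₀ ⟨i, h⟩ else 0,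
    fun x i => ?_⟩
  · simp [hN, hkl, Nat.one_le_iff_ne_zero.1 hk]
  have key : ∀ k ≤ l, ∀ i : Fin (N k), nnForward N
      (fun k i j => if k < l then A k i j else if h : (i : ℕ) < d then a ⟨i, h⟩ j else 0)
      (fun k i => if k < l then c k i else if h : (i : ℕ) < d then a₀ ⟨i, h⟩ else 0)
      k (fun j => x (Fin.cast hN0 j)) i = scalarForward W A c k (x 0) i := by
    intro k
    induction k with
    | zero =>
      intro _ i
      simp only [nnForward, scalarForward]
      exact congrArg (fun j => x j) (Subsingleton.elim _ _)
    | succ k ih =>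
      intro hk i
      have hkl : k < l := hk
      simp only [nnForward, scalarForward, Matrix.mulVec, dotProduct, hkl, if_true, ih hkl.le]
      rw [Fin.sum_univ_eq_sum_range (fun j => A k i j * scalarForward W A c k (x 0) j),
        hNk k hkl.le]
  simp only [Matrix.mulVec, dotProduct, lt_irrefl, if_false, key l le_rfl, Fin.val_cast,
    Fin.is_lt, dif_pos, Fin.eta]
  rw [Fin.sum_univ_eq_sum_range (fun j => a i j * scalarForward W A c l (x 0) j), hNk l le_rfl]
  exact ha i (x 0)

end IsFeatureSpace

end FeatureSpaces

section StepBlocks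

/-- The sequence `0, f 0, f 1, …`. -/
def consZero (f : ℕ → ℝ) : ℕ → ℝ
  | 0 => 0
  | j + 1 => f j

/-- The piecewise linear function which equals `p c * x + q c` once exactly the first `c` of the
zones `[z j - 2 * ε, z j - ε]` have been passed, and is affine on each zone when the zones are
disjoint. -/
noncomputable def zoneSum (G : ℕ) (ε : ℝ) (z p q : ℕ → ℝ) (x : ℝ) : ℝ :=
  ∑ j ∈ Finset.range G,
    (((p (j + 1) - p j) * (z j - ε) + (q (j + 1) - q j)) / ε * max (x - (z j - 2 * ε)) 0 +
      ((p (j + 1) - p j) - ((p (j + 1) - p j) * (z j - ε) + (q (j + 1) - q j)) / ε) *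
        max (x - (z j - ε)) 0)

variable {G : ℕ} {ε : ℝ} {z : ℕ → ℝ}

theorem zoneSum_mem {V : Submodule ℝ (ℝ → ℝ)}
    (h₂ : ∀ j < G, (fun x => max (x - (z j - 2 * ε)) 0) ∈ V)
    (h₁ : ∀ j < G, (fun x => max (x - (z j - ε)) 0) ∈ V) (p q : ℕ → ℝ) :
    zoneSum G ε z p q ∈ V := by
  have : zoneSum G ε z p q = ∑ j ∈ Finset.range G,
      ((((p (j + 1) - p j) * (z j - ε) + (q (j + 1) - q j)) / ε) •
          (fun x => max (x - (z j - 2 * ε)) 0) +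
        ((p (j + 1) - p j) - ((p (j + 1) - p j) * (z j - ε) + (q (j + 1) - q j)) / ε) •
          (fun x => max (x - (z j - ε)) 0)) := by
    ext x
    simp [zoneSum, Finset.sum_apply]
  rw [this]
  refine V.sum_mem fun j hj => V.add_mem (V.smul_mem _ ?_) (V.smul_mem _ ?_)
  · exact h₂ j (Finset.mem_range.1 hj)
  · exact h₁ j (Finset.mem_range.1 hj)

theorem sum_range_ite_of_iff {M : Type*} [AddCommMonoid M] {G c : ℕ} (hc : c ≤ G) (f : ℕ → M)
    {P : ℕ → Prop} [DecidablePred P] (hP : ∀ j < G, P j ↔ j < c) :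
    (∑ j ∈ Finset.range G, if P j then f j else 0) = ∑ j ∈ Finset.range c, f j := by
  rw [← Finset.sum_filter]
  congr 1
  ext j
  simp only [Finset.mem_filter, Finset.mem_range]
  exact ⟨fun h => (hP j h.1).1 h.2, fun h => ⟨h.trans_le hc, (hP j (h.trans_le hc)).2 h⟩⟩

theorem zoneSum_eq (hε : 0 < ε) {p q : ℕ → ℝ} (hp : p 0 = 0) (hq : q 0 = 0) {x : ℝ}
    (hx : ∀ j < G, 2 * ε < |x - z j|) {c : ℕ} (hc : c ≤ G) (hcx : ∀ j < G, z j < x ↔ j < c) :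
    zoneSum G ε z p q x = p c * x + q c := by
  have : zoneSum G ε z p q x = ∑ j ∈ Finset.range G,
      if j < c then (p (j + 1) * x + q (j + 1)) - (p j * x + q j) else 0 := by
    refine Finset.sum_congr rfl fun j hj => ?_
    have hj := Finset.mem_range.1 hj
    have h := hx j hj
    split_ifs with hjc
    · have hz := (hcx j hj).2 hjc
      rw [max_eq_left (by linarith), max_eq_left (by linarith)]
      field_simp
      ring
    · have hz := not_lt.1 (mt (hcx j hj).1 hjc)
      rw [abs_of_nonpos (by linarith)] at h
      rw [max_eq_right (by linarith), max_eq_right (by linarith)]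
      ring
  rw [this, sum_range_ite_of_iff hc _ fun _ _ => Iff.rfl, Finset.sum_range_sub (fun j => p j * x + q j)]
  simp [hp, hq]

theorem zoneSum_sub (p q q' : ℕ → ℝ) (x : ℝ) :
    zoneSum G ε z p q x - zoneSum G ε z p q' x = zoneSum G ε z 0 (q - q') x := by
  simp only [zoneSum, ← Finset.sum_sub_distrib]
  refine Finset.sum_congr rfl fun j _ => ?_
  simp only [Pi.zero_apply, Pi.sub_apply]
  ring

theorem abs_zoneSum_le (hε : 0 < ε) (q : ℕ → ℝ) (x : ℝ) :
    |zoneSum G ε z 0 q x| ≤ ∑ j ∈ Finset.range G, |q (j + 1) - q j| := by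
  refine (Finset.abs_sum_le_sum_abs _ _).trans (Finset.sum_le_sum fun j _ => ?_)
  have : ((((0 : ℕ → ℝ) (j + 1) - (0 : ℕ → ℝ) j) * (z j - ε) + (q (j + 1) - q j)) / ε *
        max (x - (z j - 2 * ε)) 0 + (((0 : ℕ → ℝ) (j + 1) - (0 : ℕ → ℝ) j) -
        (((0 : ℕ → ℝ) (j + 1) - (0 : ℕ → ℝ) j) * (z j - ε) + (q (j + 1) - q j)) / ε) *
        max (x - (z j - ε)) 0) =
      (q (j + 1) - q j) * ((max (x - (z j - 2 * ε)) 0 - max (x - (z j - ε)) 0) / ε) := by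
    simp only [Pi.zero_apply]
    ring
  rw [this, abs_mul]
  refine mul_le_of_le_one_right (abs_nonneg _) ?_
  rw [abs_div, abs_of_pos hε, div_le_one hε]
  refine (abs_max_sub_max_le_abs _ _ _).trans ?_
  rw [abs_le]
  constructor <;> linarith

theorem exists_le_forall_lt_iff {t : ℕ → ℝ} (ht : Monotone t) (x : ℝ) (G : ℕ) :
    ∃ c ≤ G, ∀ j < G, t j < x ↔ j < c := by
  induction G with
  | zero => exact ⟨0, le_rfl, by simp⟩
  | succ G ih =>
    by_cases hG : t G < x
    · exact ⟨G + 1, le_rfl, fun j hj => iff_of_true ((ht (by omega)).trans_lt hG) hj⟩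
    · obtain ⟨c, hc, h⟩ := ih
      refine ⟨c, by omega, fun j hj => ?_⟩
      rcases Nat.lt_succ_iff_lt_or_eq.1 hj with hj | rfl
      · exact h j hj
      · exact iff_of_false hG (by omega)

theorem relu_ramp_sub (hε : 0 < ε) (h t : ℝ) {x : ℝ} (hx : 2 * ε < |x - t|) :
    max (h / ε * x + (max (-h) 0 - h / ε * t)) 0 - max (h / ε * x + (-max h 0 - h / ε * t)) 0
      = max (-h) 0 + if t < x then h else 0 := by
  have e₁ : h / ε * x + (max (-h) 0 - h / ε * t) = h * ((x - t) / ε) + max (-h) 0 := by ring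
  have e₂ : h / ε * x + (-max h 0 - h / ε * t) = h * ((x - t) / ε) - max h 0 := by ring
  rw [e₁, e₂]
  split_ifs with htx
  · have hy : 1 ≤ (x - t) / ε := by
      rw [abs_of_pos (by linarith)] at hx
      rw [le_div_iff₀ hε]
      linarith
    generalize (x - t) / ε = y at hy
    rcases le_total 0 h with hh | hh
    · rw [max_eq_right (a := -h) (by linarith), max_eq_left hh, max_eq_left (by nlinarith),
        max_eq_left (by nlinarith)]
      ring
    · rw [max_eq_left (a := -h) (by linarith), max_eq_right (a := h) hh,
        max_eq_right (by nlinarith), max_eq_right (by nlinarith)]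
      ring
  · have hy : (x - t) / ε ≤ 0 := div_nonpos_of_nonpos_of_nonneg (by linarith) hε.le
    generalize (x - t) / ε = y at hy
    rcases le_total 0 h with hh | hh
    · rw [max_eq_right (a := -h) (by linarith), max_eq_left hh, max_eq_right (by nlinarith),
        max_eq_right (by nlinarith)]
      ring
    · rw [max_eq_left (a := -h) (by linarith), max_eq_right (a := h) hh,
        max_eq_left (by nlinarith), max_eq_left (by nlinarith)]
      ring

/-- A step function with `G * S` jumps is, up to small neighbourhoods of the jumps, a combination
of `2 * S + 1` neurons acting on `2 * G` hinge functions. -/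
theorem exists_step_block (G : ℕ) {S : ℕ} (hS : 0 < S) (h : ℕ → ℝ) :
    ∃ R B : ℝ, ∀ t : ℕ → ℝ, Monotone t → ∀ ε > 0, ∀ V : Submodule ℝ (ℝ → ℝ),
      (∀ a : ℝ, (fun _ => a) ∈ V) →
      (∀ j < G, (fun x => max (x - (t (j * S) - 2 * ε)) 0) ∈ V) →
      (∀ j < G, (fun x => max (x - (t (j * S) - ε)) 0) ∈ V) →
      ∃ (ga gb : Fin S → ℝ → ℝ) (gc : ℝ → ℝ), (∀ k, ga k ∈ V) ∧ (∀ k, gb k ∈ V) ∧ gc ∈ V ∧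
        (∀ x, |∑ k, (max (ga k x) 0 - max (gb k x) 0) + (max (gc x) 0 - B)| ≤ R) ∧
        ∀ x, (∀ r < G * S, 2 * ε < |x - t r|) →
          ∑ k, (max (ga k x) 0 - max (gb k x) 0) + (max (gc x) 0 - B) =
            ∑ r ∈ Finset.range (G * S), if t r < x then h r else 0 := by
  set β : ℕ → ℝ := fun j =>
    ∑ r ∈ Finset.range (j * S), h r - ∑ k : Fin S, max (-h (j * S + k)) 0 with hβ
  set B : ℝ := ∑ j ∈ Finset.range G, |consZero β (j + 1) - consZero β j| with hB
  have hB0 : 0 ≤ B := Finset.sum_nonneg fun _ _ => abs_nonneg _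
  set D : Fin S → ℕ → ℝ := fun k => consZero fun j => |h (j * S + k)| with hD
  refine ⟨∑ k, ∑ j ∈ Finset.range G, |D k (j + 1) - D k j| + B, B,
    fun t ht ε hε V hV₀ hV₂ hV₁ => ?_⟩
  set z : ℕ → ℝ := fun j => t (j * S) with hz
  set p : Fin S → ℕ → ℝ := fun k => consZero fun j => h (j * S + k) / ε with hp
  set qa : Fin S → ℕ → ℝ := fun k => consZero fun j =>
    max (-h (j * S + k)) 0 - h (j * S + k) / ε * t (j * S + k) with hqa
  set qb : Fin S → ℕ → ℝ := fun k => consZero fun j =>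
    -max (h (j * S + k)) 0 - h (j * S + k) / ε * t (j * S + k) with hqb
  have hq : ∀ k, qa k - qb k = D k := by
    intro k
    ext j
    cases j with
    | zero => simp [hqa, hqb, hD, consZero]
    | succ j =>
      simp only [hqa, hqb, hD, consZero, Pi.sub_apply]
      rcases le_total 0 (h (j * S + k)) with hh | hh
      · rw [max_eq_right (by linarith), max_eq_left hh, abs_of_nonneg hh]
        ring
      · rw [max_eq_left (by linarith), max_eq_right hh, abs_of_nonpos hh]
        ring
  have hgc : ∀ x, max (zoneSum G ε z 0 (consZero β) x + B) 0 - B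
      = zoneSum G ε z 0 (consZero β) x := by
    intro x
    have := abs_le.1 (abs_zoneSum_le (G := G) (z := z) hε (consZero β) x)
    rw [max_eq_left (by linarith)]
    ring
  refine ⟨fun k => zoneSum G ε z (p k) (qa k), fun k => zoneSum G ε z (p k) (qb k),
    fun x => zoneSum G ε z 0 (consZero β) x + B, fun k => zoneSum_mem hV₂ hV₁ _ _,
    fun k => zoneSum_mem hV₂ hV₁ _ _, V.add_mem (zoneSum_mem hV₂ hV₁ _ _) (hV₀ B),
    fun x => ?_, fun x hx => ?_⟩
  · rw [hgc]
    refine (abs_add_le _ _).trans (add_le_add ?_ (abs_zoneSum_le hε _ _))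
    refine (Finset.abs_sum_le_sum_abs _ _).trans (Finset.sum_le_sum fun k _ => ?_)
    refine (abs_max_sub_max_le_abs _ _ _).trans ?_
    rw [zoneSum_sub, hq]
    exact abs_zoneSum_le hε _ _
  · simp only [hgc]
    have hzm : Monotone z := fun i j hij => ht (Nat.mul_le_mul_right S hij)
    obtain ⟨c, hcG, hc⟩ := exists_le_forall_lt_iff hzm x G
    have hxz : ∀ j < G, 2 * ε < |x - z j| := fun j hj => hx _ (Nat.mul_lt_mul_of_pos_right hj hS)
    rw [zoneSum_eq hε rfl rfl hxz hcG hc]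
    have e₁ : ∀ k, zoneSum G ε z (p k) (qa k) x = p k c * x + qa k c := fun k =>
      zoneSum_eq hε rfl rfl hxz hcG hc
    have e₂ : ∀ k, zoneSum G ε z (p k) (qb k) x = p k c * x + qb k c := fun k =>
      zoneSum_eq hε rfl rfl hxz hcG hc
    simp only [e₁, e₂]
    cases c with
    | zero =>
      simp only [hp, hqa, hqb, consZero]
      symm
      rw [Finset.sum_eq_zero]
      · simp
      · intro r hr
        have hG : 0 < G := Nat.pos_of_ne_zero fun h0 => by simp [h0] at hr
        have h0 := not_lt.1 (mt (hc 0 hG).1 (lt_irrefl 0))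
        rw [if_neg]
        simp only [hz, zero_mul] at h0
        exact not_lt.2 (h0.trans (ht (Nat.zero_le r)))
    | succ c =>
      have hle : c * S + S ≤ G * S := by
        have := Nat.mul_le_mul_right S hcG
        rwa [Nat.succ_mul] at this
      obtain ⟨e, he⟩ := Nat.exists_eq_add_of_le hle
      have hk : ∀ k : Fin S, c * S + (k : ℕ) < G * S := fun k => by omega
      simp only [hp, hqa, hqb, consZero, Pi.zero_apply, zero_mul, zero_add, hβ]
      rw [Finset.sum_congr rfl fun k _ => relu_ramp_sub hε _ _ (hx _ (hk k)),
        Finset.sum_add_distrib, he, Finset.sum_range_add, Finset.sum_range_add]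
      rw [Fin.sum_univ_eq_sum_range (fun k => if t (c * S + k) < x then h (c * S + k) else 0) S]
      have h₁ : (∑ r ∈ Finset.range (c * S), if t r < x then h r else 0)
          = ∑ r ∈ Finset.range (c * S), h r :=
        Finset.sum_congr rfl fun r hr => if_pos
          ((ht (Finset.mem_range.1 hr).le).trans_lt ((hc c (by omega)).2 (by omega)))
      have h₃ : (∑ r ∈ Finset.range e, if t (c * S + S + r) < x then h (c * S + S + r) else 0)
          = 0 := by
        refine Finset.sum_eq_zero fun r hr => if_neg (not_lt.2 ?_)
        have hcG' : c + 1 < G := by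
          refine lt_of_le_of_ne hcG fun hcG' => ?_
          rw [← hcG', Nat.succ_mul] at he
          have := Finset.mem_range.1 hr
          omega
        have := not_lt.1 (mt (hc (c + 1) hcG').1 (lt_irrefl _))
        refine this.trans (ht ?_)
        rw [Nat.succ_mul]
        omega
      rw [h₁, h₃]
      ring

end StepBlocks

section StepNetworks

theorem max_sub_zero_congr {s x a u : ℝ} (h : max s a = max x a) (hu : a ≤ u) :
    max (s - u) 0 = max (x - u) 0 := by
  have e : ∀ y : ℝ, max (y - u) 0 = max (max y a) u - u := fun y => by
    rw [max_assoc, max_eq_right hu, ← max_sub_sub_right, sub_self]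
  rw [e, e, h]

/-- Feature spaces of depth `2 * b` contain vector-valued step functions with `b * (G * S)` jumps,
up to small neighbourhoods of the jumps, with a bound uniform in the positions of the jumps. -/
theorem exists_step_features {d W G S : ℕ} (hS : 0 < S) (hG : 1 + d + 2 * G ≤ W)
    (hSW : 1 + d + d * (2 * S + 1) ≤ W) (h : ℕ → Fin d → ℝ) (b : ℕ) :
    ∃ R : ℝ, ∀ t : ℕ → ℝ, Monotone t → ∀ ε > 0,
      ∃ (V : Submodule ℝ (ℝ → ℝ)) (s : ℝ → ℝ) (P : Fin d → ℝ → ℝ),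
        IsFeatureSpace W (2 * b) V ∧ s ∈ V ∧
        (∀ x, max (s x) (t 0 - 2 * ε) = max x (t 0 - 2 * ε)) ∧
        (∀ i, P i ∈ V) ∧ (∀ i x, |P i x| ≤ R) ∧
        ∀ x, (∀ r < b * (G * S), 2 * ε < |x - t r|) → ∀ i,
          P i x = ∑ r ∈ Finset.range (b * (G * S)), if t r < x then h r i else 0 := by
  induction b with
  | zero =>
    refine ⟨0, fun t _ ε _ => ⟨_, fun x => x, 0, .input, Submodule.subset_span (by simp),
      fun _ => rfl, fun _ => Submodule.zero_mem _, by simp, by simp⟩⟩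
  | succ b ih =>
    obtain ⟨R, hR⟩ := ih
    choose Rb B hblock using fun i => exists_step_block G hS fun r => h (b * (G * S) + r) i
    refine ⟨R + ∑ i, |Rb i|, fun t ht ε hε => ?_⟩
    obtain ⟨V, s, P, hV, hsV, hs, hPV, hPR, hP⟩ := hR t ht ε hε
    set t' : ℕ → ℝ := fun r => t (b * (G * S) + r) with ht'
    have ht'm : Monotone t' := fun i j hij => ht (by omega)
    set a := t 0 - 2 * ε with ha
    have hta : ∀ r, a ≤ t' r - 2 * ε := fun r => by
      have : t 0 ≤ t' r := ht (Nat.zero_le _)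
      linarith
    obtain ⟨V₁, hV₁, hmem₁⟩ := hV.exists_succ (ι := Unit ⊕ Fin d ⊕ Fin G ⊕ Fin G)
      (by simp; omega)
      (Sum.elim (fun _ x => s x - a) (Sum.elim (fun i x => P i x + R)
        (Sum.elim (fun j x => s x - (t' (j * S) - 2 * ε)) (fun j x => s x - (t' (j * S) - ε)))))
      (by
        rintro (_ | i | j | j)
        · exact V.sub_mem hsV (hV.const_mem a)
        · exact V.add_mem (hPV i) (hV.const_mem R)
        · exact V.sub_mem hsV (hV.const_mem _)
        · exact V.sub_mem hsV (hV.const_mem _))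
    have hPnn : ∀ i x, max (P i x + R) 0 = P i x + R := fun i x =>
      max_eq_left (by linarith [(abs_le.1 (hPR i x)).1])
    have hP₁ : ∀ i, (fun x => P i x + R) ∈ V₁ := fun i => by
      convert hmem₁ (.inr (.inl i)) using 2 with x
      exact (hPnn i x).symm
    have hs₁ : (fun x => max (s x - a) 0) ∈ V₁ := hmem₁ (.inl ())
    have hh₂ : ∀ j < G, (fun x => max (x - (t' (j * S) - 2 * ε)) 0) ∈ V₁ := fun j hj => by
      convert hmem₁ (.inr (.inr (.inl ⟨j, hj⟩))) using 2 with x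
      exact (max_sub_zero_congr (hs x) (hta _)).symm
    have hh₁ : ∀ j < G, (fun x => max (x - (t' (j * S) - ε)) 0) ∈ V₁ := fun j hj => by
      convert hmem₁ (.inr (.inr (.inr ⟨j, hj⟩))) using 2 with x
      exact (max_sub_zero_congr (hs x) ((hta (j * S)).trans (by linarith))).symm
    choose ga gb gc hga hgb hgc hFR hF using fun i =>
      hblock i t' ht'm ε hε V₁ hV₁.const_mem hh₂ hh₁
    obtain ⟨V₂, hV₂, hmem₂⟩ := hV₁.exists_succ
      (ι := Unit ⊕ Fin d ⊕ (Fin d × Fin S) ⊕ (Fin d × Fin S) ⊕ Fin d)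
      (by simp; linarith)
      (Sum.elim (fun _ x => max (s x - a) 0) (Sum.elim (fun i x => P i x + R)
        (Sum.elim (fun k => ga k.1 k.2) (Sum.elim (fun k => gb k.1 k.2) gc))))
      (by
        rintro (_ | i | k | k | i)
        exacts [hs₁, hP₁ i, hga _ _, hgb _ _, hgc i])
    refine ⟨V₂, fun x => max (s x - a) 0 + a, fun i x => P i x +
      (∑ k, (max (ga i k x) 0 - max (gb i k x) 0) + (max (gc i x) 0 - B i)), hV₂, ?_,
      fun x => ?_, fun i => ?_, fun i x => ?_, fun x hx i => ?_⟩
    · refine V₂.add_mem ?_ (hV₂.const_mem a)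
      convert hmem₂ (.inl ()) using 2 with x
      exact (max_eq_left (le_max_right _ _)).symm
    · beta_reduce
      rw [← max_add_add_right, sub_add_cancel, zero_add, hs, max_assoc, max_self]
    · refine V₂.add_mem ?_ (V₂.add_mem ?_ (V₂.sub_mem (hmem₂ (.inr (.inr (.inr (.inr i)))))
        (hV₂.const_mem _)))
      · convert V₂.sub_mem (hmem₂ (.inr (.inl i))) (hV₂.const_mem R) using 1
        ext x
        simp [hPnn]
      · convert V₂.sum_mem (t := Finset.univ) (f := fun k => (fun x => max (ga i k x) 0) -
          (fun x => max (gb i k x) 0)) fun k _ => V₂.sub_mem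
            (hmem₂ (.inr (.inr (.inl (i, k))))) (hmem₂ (.inr (.inr (.inr (.inl (i, k)))))) using 1
        ext x
        simp
    · exact (abs_add_le _ _).trans (add_le_add (hPR i x) ((hFR i x).trans ((le_abs_self _).trans
        (Finset.single_le_sum (f := fun i => |Rb i|) (fun _ _ => abs_nonneg _)
          (Finset.mem_univ i)))))
    · have e : (b + 1) * (G * S) = b * (G * S) + G * S := Nat.succ_mul _ _
      beta_reduce
      rw [hP x (fun r hr => hx r (by omega)) i,
        hF i x (fun r hr => hx _ (by omega)), e, Finset.sum_range_add]

theorem exists_step_network {d W L J G S : ℕ} (hJ : 1 ≤ J) (hJL : 2 * J ≤ L) (hS : 0 < S)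
    (hG : 1 + d + 2 * G ≤ W) (hSW : 1 + d + d * (2 * S + 1) ≤ W)
    (y₀ : EuclideanSpace ℝ (Fin d)) (h : ℕ → EuclideanSpace ℝ (Fin d)) :
    ∃ R : ℝ, ∀ t : ℕ → ℝ, Monotone t → ∀ ε > 0, ∃ φ ∈ NNset1 d W L, Measurable φ ∧
      (∀ x, ‖φ x‖ ≤ R) ∧ ∀ x, (∀ r < J * (G * S), 2 * ε < |x - t r|) →
        φ x = y₀ + ∑ r ∈ Finset.range (J * (G * S)), if t r < x then h r else 0 := by
  obtain ⟨R, hR⟩ := exists_step_features hS hG hSW (fun r i => h r i) J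
  refine ⟨√(∑ _i : Fin d, R ^ 2) + ‖y₀‖, fun t ht ε hε => ?_⟩
  obtain ⟨V, s, P, hV, -, -, hPV, hPR, hP⟩ := hR t ht ε hε
  refine ⟨fun x => WithLp.toLp 2 (fun i => P i x) + y₀, hV.mem_NNset1 (by omega) hJL _ fun i => ?_,
    ?_, fun x => (norm_add_le _ _).trans ?_, fun x hx => ?_⟩
  · simp only [PiLp.add_apply]
    exact V.add_mem (hPV i) (hV.const_mem _)
  · refine Measurable.add_const ?_ _
    exact (WithLp.measurable_toLp 2 _).comp (measurable_pi_lambda _ fun i =>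
      hV.measurable _ (hPV i))
  · gcongr
    rw [EuclideanSpace.norm_eq]
    refine Real.sqrt_le_sqrt (Finset.sum_le_sum fun i _ => ?_)
    gcongr
    exact hPR i x
  · ext i
    simp only [PiLp.add_apply, hP x hx i, WithLp.ofLp_sum, Finset.sum_apply]
    rw [add_comm]
    congr 1
    refine Finset.sum_congr rfl fun r _ => ?_
    split_ifs <;> rfl

end StepNetworks

section Transport

theorem Wdist_map_le {Ω E : Type*} [MeasurableSpace Ω] [MeasurableSpace E]
    [PseudoEMetricSpace E] {p : ℝ} (hp : 0 < p) (ν : Measure Ω) {f g : Ω → E} (hf : Measurable f)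
    (hg : Measurable g) {M : ℝ≥0∞} {A : Set Ω} (hA : MeasurableSet A)
    (hM : ∀ x, edist (f x) (g x) ≤ M) (hfg : ∀ x ∉ A, edist (f x) (g x) = 0) :
    Wdist p (ν.map f) (ν.map g) ≤ (M ^ p * ν A) ^ (1 / p) := by
  refine ENNReal.rpow_le_rpow ?_ (by positivity)
  refine (iInf₂_le (ν.map fun x => (f x, g x)) ⟨?hfst, ?hsnd⟩).trans ?_
  case hfst => rw [Measure.map_map measurable_fst (hf.prodMk hg)]; rfl
  case hsnd => rw [Measure.map_map measurable_snd (hf.prodMk hg)]; rfl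
  · refine (lintegral_map_le _ _).trans ?_
    rw [← lintegral_indicator_const hA]
    refine lintegral_mono fun x => ?_
    by_cases hx : x ∈ A
    · simpa [hx] using ENNReal.rpow_le_rpow (hM x) hp.le
    · simp [hx, hfg x hx, hp]

theorem exists_measure_Iic_eq (ν : Measure ℝ) [IsProbabilityMeasure ν] [NullSingletonClass ν] {c : ℝ≥0∞}
    (h0 : 0 < c) (h1 : c < 1) : ∃ q, ν (Iic q) = c := by
  have hcont : Continuous (ProbabilityTheory.cdf ν) := by
    rw [continuous_iff_continuousAt]
    intro a
    rw [(ProbabilityTheory.cdf ν).mono.continuousAt_iff_leftLim_eq_rightLim,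
      (ProbabilityTheory.cdf ν).rightLim_eq]
    have h := (ProbabilityTheory.cdf ν).measure_singleton a
    rw [ProbabilityTheory.measure_cdf, measure_singleton, eq_comm, ENNReal.ofReal_eq_zero] at h
    exact le_antisymm ((ProbabilityTheory.cdf ν).mono.leftLim_le le_rfl) (by linarith)
  have hc : c ≠ ⊤ := (h1.trans ENNReal.one_lt_top).ne
  have h0' : 0 < c.toReal := ENNReal.toReal_pos h0.ne' hc
  have h1' : c.toReal < 1 := by
    simpa using (ENNReal.toReal_lt_toReal hc ENNReal.one_ne_top).2 h1
  obtain ⟨a, ha⟩ := ((ProbabilityTheory.tendsto_cdf_atBot ν).eventually_lt_const h0').exists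
  obtain ⟨b, hb⟩ := ((ProbabilityTheory.tendsto_cdf_atTop ν).eventually_const_lt h1').exists
  obtain ⟨q, hq⟩ := mem_range_of_exists_le_of_exists_ge hcont ⟨a, ha.le⟩ ⟨b, hb.le⟩
  refine ⟨q, ?_⟩
  rw [ProbabilityTheory.cdf_eq_real, measureReal_def] at hq
  exact (ENNReal.toReal_eq_toReal_iff' (measure_ne_top _ _) hc).1 hq

theorem exists_pos_weights {d n : ℕ} {μ : Measure (EuclideanSpace ℝ (Fin d))}
    (hμ : μ ∈ discreteP d n) : ∃ (N : ℕ) (y : ℕ → EuclideanSpace ℝ (Fin d)) (w : ℕ → ℝ≥0∞),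
      N + 1 ≤ n ∧ (∀ i ≤ N, w i ≠ 0) ∧ (∀ i, N ≤ i → y i = y N) ∧
      ∑ i ∈ Finset.range (N + 1), w i = 1 ∧
      μ = ∑ i ∈ Finset.range (N + 1), w i • Measure.dirac (y i) := by
  obtain ⟨x, w, hw, rfl⟩ := hμ
  set s : Finset (Fin n) := Finset.univ.filter fun i => w i ≠ 0 with hs
  have hsum : ∑ i ∈ s, w i = 1 := by rw [← hw, hs, Finset.sum_filter_ne_zero]
  have hpos : 0 < s.card := by
    rw [Finset.card_pos, Finset.nonempty_iff_ne_empty]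
    rintro h
    simp [h] at hsum
  obtain ⟨N, hN⟩ : ∃ N, s.card = N + 1 := ⟨s.card - 1, by omega⟩
  have e : Fin (N + 1) ≃ s := (s.equivFinOfCardEq hN).symm
  have hfin : ∀ i, min i N < N + 1 := fun i => by omega
  have hsumE : ∀ {M : Type} [AddCommMonoid M] (f : Fin n → M),
      ∑ i ∈ Finset.range (N + 1), f (e ⟨min i N, hfin i⟩) = ∑ i ∈ s, f i := by
    intro M _ f
    rw [← Finset.sum_coe_sort s f, ← e.sum_comp,
      ← Fin.sum_univ_eq_sum_range (fun i => f (e ⟨min i N, hfin i⟩))]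
    refine Finset.sum_congr rfl fun i _ => ?_
    congr 3
    ext
    simp only
    omega
  refine ⟨N, fun i => x (e ⟨min i N, hfin i⟩), fun i => w (e ⟨min i N, hfin i⟩), ?_, ?_, ?_, ?_, ?_⟩
  · rw [← hN]
    simpa using s.card_le_univ
  · intro i _
    exact (Finset.mem_filter.1 (e ⟨min i N, hfin i⟩).2).2
  · intro i hi
    simp [hi]
  · rw [hsumE w, hsum]
  · rw [hsumE fun i => w i • Measure.dirac (x i), hs, Finset.sum_filter_of_ne]
    intro i _ hi hwi
    exact hi (by simp [hwi])

/-- A measure without atoms on the line is transported to any nondegenerate distribution on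
`{0, …, N}` by counting the quantiles below a point. -/
theorem exists_quantiles (ν : Measure ℝ) [IsProbabilityMeasure ν] [NullSingletonClass ν] {N : ℕ}
    {w : ℕ → ℝ≥0∞} (hw : ∀ i ≤ N, w i ≠ 0) (hsum : ∑ i ∈ Finset.range (N + 1), w i = 1) :
    ∃ (t : ℕ → ℝ) (k : ℝ → ℕ), Monotone t ∧ Measurable k ∧ (∀ x, k x ≤ N) ∧
      (∀ x, ∀ r < N, t r < x ↔ r < k x) ∧
      ν.map k = ∑ i ∈ Finset.range (N + 1), w i • Measure.dirac i := by
  have hle : ∀ r < N, ∑ i ∈ Finset.range (r + 1), w i + w (r + 1) ≤ 1 := fun r hr => by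
    rw [← Finset.sum_range_succ, ← hsum]
    exact Finset.sum_le_sum_of_subset (Finset.range_mono (by omega))
  have hlt : ∀ r < N, ∑ i ∈ Finset.range (r + 1), w i < ∑ i ∈ Finset.range (r + 2), w i := by
    intro r hr
    rw [Finset.sum_range_succ _ (r + 1)]
    exact ENNReal.lt_add_right
      (ne_top_of_le_ne_top ENNReal.one_ne_top (le_self_add.trans (hle r hr))) (hw _ hr)
  have hq : ∀ r, ∃ q, r < N → ν (Iic q) = ∑ i ∈ Finset.range (r + 1), w i := by
    intro r
    by_cases hr : r < N
    · obtain ⟨q, hq⟩ := exists_measure_Iic_eq ν (c := ∑ i ∈ Finset.range (r + 1), w i)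
        ((pos_iff_ne_zero.2 (hw r hr.le)).trans_le
          (Finset.single_le_sum (fun _ _ => zero_le) (Finset.self_mem_range_succ r)))
        ((hlt r hr).trans_le (by rw [Finset.sum_range_succ]; exact hle r hr))
      exact ⟨q, fun _ => hq⟩
    · exact ⟨0, fun h => absurd h hr⟩
  choose q hq using hq
  have hqm : ∀ i j, i ≤ j → j < N → q i ≤ q j := by
    intro i j hij hj
    rcases hij.eq_or_lt with rfl | hij
    · exact le_rfl
    by_contra! hlt'
    have h := measure_mono (μ := ν) (Iic_subset_Iic.2 hlt'.le)
    rw [hq j hj, hq i (by omega)] at h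
    refine (lt_of_lt_of_le (hlt i (by omega)) ?_).not_ge h
    exact Finset.sum_le_sum_of_subset (Finset.range_mono (by omega))
  set t : ℕ → ℝ := fun r => q (min r (N - 1)) with ht
  have htm : Monotone t := fun i j hij => by
    rcases Nat.eq_zero_or_pos N with rfl | hN
    · simp [ht]
    · exact hqm _ _ (by omega) (by omega)
  have htq : ∀ r < N, ν (Iic (t r)) = ∑ i ∈ Finset.range (r + 1), w i := fun r hr => by
    rw [ht, ← hq r hr]
    simp only
    rw [min_eq_left (by omega)]
  set k : ℝ → ℕ := fun x => ∑ r ∈ Finset.range N, if t r < x then 1 else 0 with hk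
  have hk' : ∀ x, k x ≤ N ∧ ∀ r < N, t r < x ↔ r < k x := fun x => by
    obtain ⟨c, hcN, hc⟩ := exists_le_forall_lt_iff htm x N
    have : k x = c := by
      rw [hk]
      simp only
      rw [sum_range_ite_of_iff hcN _ hc]
      simp
    rw [this]
    exact ⟨hcN, hc⟩
  have hkm : Measurable k := Finset.measurable_sum _ fun r _ =>
    Measurable.ite measurableSet_Ioi measurable_const measurable_const
  refine ⟨t, k, htm, hkm, fun x => (hk' x).1, fun x => (hk' x).2, ?_⟩
  have : IsFiniteMeasure (ν.map k) := inferInstance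
  refine Measure.ext_of_Iic _ _ fun i => ?_
  rw [Measure.map_apply hkm measurableSet_Iic, Measure.finsetSum_apply]
  have e : ∀ l ∈ Finset.range (N + 1), (w l • Measure.dirac l) (Iic i)
      = if l < i + 1 then w l else 0 := fun l _ => by
    simp [Set.indicator_apply]
  rw [Finset.sum_congr rfl e]
  by_cases hi : i < N
  · rw [sum_range_ite_of_iff (by omega) _ fun _ _ => Iff.rfl, ← htq i hi]
    congr 1
    ext x
    simp only [mem_preimage, mem_Iic]
    rw [← not_lt, ← (hk' x).2 i hi, not_lt]
  · have : k ⁻¹' Iic i = univ := eq_univ_of_forall fun x => (hk' x).1.trans (not_lt.1 hi)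
    rw [this, measure_univ, ← hsum]
    refine Finset.sum_congr rfl fun l hl => (if_pos ?_).symm
    have := Finset.mem_range.1 hl
    omega

theorem two_mul_width_count {d W L n : ℕ} (hd : 0 < d) (hW : 7 * d + 1 ≤ W) (hL : 2 ≤ L)
    (hn : (n : ℝ) ≤ ((W : ℝ) - d - 1) / 2 * (((W - d - 1) / (6 * d) : ℕ) : ℝ) *
      ((L / 2 : ℕ) : ℝ) + 2) :
    n ≤ L / 2 * ((W - d - 1) / 2 * (2 * ((W - d - 1) / (6 * d)))) + 1 := by
  obtain ⟨m, rfl⟩ : ∃ m, W = m + d + 1 := ⟨W - d - 1, by omega⟩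
  have hm : m + d + 1 - d - 1 = m := by omega
  rw [hm] at hn ⊢
  have hm6 : 6 ≤ m := by omega
  have hK : 1 ≤ m / (6 * d) := (Nat.one_le_div_iff (by omega)).2 (by omega)
  have hJ : 1 ≤ L / 2 := by omega
  have hG : m ≤ 2 * (m / 2) + 1 := by omega
  generalize m / (6 * d) = K at *
  generalize L / 2 = J at *
  generalize m / 2 = G at *
  have hn' : 2 * n ≤ m * (K * J) + 4 := by
    have : (2 * n : ℝ) ≤ m * (K * J) + 4 := by
      push_cast at hn
      linarith
    exact_mod_cast this
  have hKJ : 1 ≤ K * J := Nat.mul_pos hK hJ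
  have e : J * (G * (2 * K)) = (2 * G) * (K * J) := by ring
  rw [e]
  generalize K * J = Q at *
  nlinarith

end Transport

/-- Lemma: ReLU networks can transform an absolutely continuous distribution
into any discrete distribution, up to arbitrarily small Wasserstein distance. -/
theorem statement6 (p : ℝ) (hp : 1 ≤ p) (d W L n : ℕ) (hd : 0 < d)
    (hW : 7 * d + 1 ≤ W) (hL : 2 ≤ L)
    (ν : Measure ℝ) [IsProbabilityMeasure ν] (hν : ν ≪ volume)
    (hn : (n : ℝ) ≤ ((W : ℝ) - d - 1) / 2 * (((W - d - 1) / (6 * d) : ℕ) : ℝ) *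
      ((L / 2 : ℕ) : ℝ) + 2)
    (μ : Measure (EuclideanSpace ℝ (Fin d))) (hμ : μ ∈ discreteP d n) :
    (⨅ φ ∈ NNset1 d W L, Wdist p μ (ν.map φ)) = 0 := by
  have : NullSingletonClass ν := ⟨fun x => hν (measure_singleton x)⟩
  have hp0 : 0 < p := by linarith
  obtain ⟨N, y, w, hNn, hw, hy, hsum, rfl⟩ := exists_pos_weights hμ
  obtain ⟨t, k, htm, hkm, hkN, hk, hkν⟩ := exists_quantiles ν hw hsum
  have hK : 1 ≤ (W - d - 1) / (6 * d) := (Nat.one_le_div_iff (by omega)).2 (by omega)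
  have hKm : 6 * d * ((W - d - 1) / (6 * d)) ≤ W - d - 1 := Nat.mul_div_le _ _
  have hcount := two_mul_width_count hd hW hL hn
  have hSW : 1 + d + d * (2 * (2 * ((W - d - 1) / (6 * d))) + 1) ≤ W := by
    have : d * (2 * (2 * ((W - d - 1) / (6 * d))) + 1) ≤ 6 * d * ((W - d - 1) / (6 * d)) := by
      nlinarith
    omega
  set G := (W - d - 1) / 2
  set S := 2 * ((W - d - 1) / (6 * d))
  set J := L / 2
  obtain ⟨R, hR⟩ := exists_step_network (d := d) (W := W) (L := L) (J := J) (G := G) (S := S)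
    (by omega) (by omega) (by omega) (by omega) hSW (y 0) fun r => y (r + 1) - y r
  set Q := J * (G * S)
  have hstep : ∀ x, y (k x) = y 0 +
      ∑ r ∈ Finset.range Q, if t r < x then y (r + 1) - y r else 0 := by
    intro x
    have h₁ : (∑ r ∈ Finset.range Q, if t r < x then y (r + 1) - y r else 0) =
        ∑ r ∈ Finset.range N, if t r < x then y (r + 1) - y r else 0 := by
      refine (Finset.sum_subset (Finset.range_mono (by omega)) fun r _ hr => ?_).symm
      rw [Finset.mem_range, not_lt] at hr
      rw [hy r hr, hy (r + 1) (by omega), sub_self, ite_self]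
    rw [h₁, sum_range_ite_of_iff (hkN x) _ (hk x), Finset.sum_range_sub]
    abel
  have hym : Measurable fun x => y (k x) := (measurable_of_countable y).comp hkm
  have hμν : ν.map (fun x => y (k x)) =
      ∑ i ∈ Finset.range (N + 1), w i • Measure.dirac (y i) := by
    rw [show (fun x => y (k x)) = y ∘ k from rfl,
      ← Measure.map_map (measurable_of_countable y) hkm, hkν]
    ext A hA
    rw [Measure.map_apply (measurable_of_countable y) hA]
    simp [Measure.finsetSum_apply, Measure.dirac_apply' _ hA, ← Set.indicator_comp_right]
  rw [← hμν]
  set T : Set ℝ := t '' (Finset.range Q : Set ℕ)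
  have hT : T.Finite := (Finset.finite_toSet _).image t
  set M : ℝ≥0∞ := ENNReal.ofReal (∑ i ∈ Finset.range (N + 1), ‖y i‖ + R)
  have hbound : ∀ ε > 0, (⨅ φ ∈ NNset1 d W L, Wdist p (ν.map fun x => y (k x)) (ν.map φ)) ≤
      (M ^ p * ν (cthickening (2 * ε) T)) ^ (1 / p) := by
    intro ε hε
    obtain ⟨φ, hφ, hφm, hφR, hφx⟩ := hR t htm ε hε
    refine (iInf₂_le φ hφ).trans (Wdist_map_le hp0 ν hym hφm isClosed_cthickening.measurableSet
      (fun x => ?_) fun x hx => ?_)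
    · rw [edist_dist]
      refine ENNReal.ofReal_le_ofReal ((dist_le_norm_add_norm _ _).trans (add_le_add ?_ (hφR x)))
      exact Finset.single_le_sum (f := fun i => ‖y i‖) (fun _ _ => norm_nonneg _)
        (Finset.mem_range.2 (Nat.lt_succ_of_le (hkN x)))
    · rw [hφx x, hstep x, edist_self]
      intro r hr
      by_contra! hle
      exact hx (mem_cthickening_of_dist_le x (t r) _ T
        ⟨r, by simpa using hr, rfl⟩ (by rwa [Real.dist_eq]))
  have hlim : Tendsto (fun ε : ℝ => (M ^ p * ν (cthickening (2 * ε) T)) ^ (1 / p)) (𝓝[>] 0)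
      (𝓝 0) := by
    have h₁ : Tendsto (fun ε : ℝ => ν (cthickening (2 * ε) T)) (𝓝[>] 0) (𝓝 0) := by
      have h := tendsto_measure_cthickening_of_isClosed (μ := ν) (s := T)
        ⟨1, one_pos, measure_ne_top _ _⟩ hT.isClosed
      rw [hT.measure_zero] at h
      refine h.comp (Tendsto.mono_left ?_ nhdsWithin_le_nhds)
      have : Continuous fun ε : ℝ => 2 * ε := by fun_prop
      simpa using this.tendsto 0
    have hM : M ^ p ≠ ⊤ := ENNReal.rpow_ne_top_of_nonneg hp0.le ENNReal.ofReal_ne_top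
    have h₂ := (ENNReal.Tendsto.const_mul h₁ (Or.inr hM)).ennrpow_const (1 / p)
    rwa [mul_zero, ENNReal.zero_rpow_of_pos (by positivity)] at h₂
  exact le_antisymm (ge_of_tendsto hlim (eventually_mem_nhdsWithin.mono hbound)) zero_le
end

section
/- Let $1 \le p < q < \infty$ and let $\mu$ be a probability distribution on $\mathbb{R}^d$ with finite absolute $q$-moment $M_q(\mu) < \infty$. Then there exists a constant $C_{p,q,d}$ depending only on $p$, $q$ and $d$ such that for all $n \in \mathbb{N}$: if $q > p + p/d$ then $\inf_{\gamma \in \mathcal{P}(n)} W_p(\mu, \gamma) \le C_{p,q,d} (M_q^q(\mu)+1)^{1/p} n^{-1/d}$, and if $p < q \le p + p/d$ then $\inf_{\gamma \in \mathcal{P}(n)} W_p(\mu, \gamma) \le C_{p,q,d} (M_q^q(\mu)+1)^{1/p} (n/\log_2 n)^{-1/d}$. -/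
open MeasureTheory Filter Topology Metric Set
open scoped ENNReal NNReal

open Module (finrank)

/-- A finite set of points `y` with `h * (1 + ‖y‖) ^ s ≤ 1 + ‖y‖` such that the balls of radius
`h * (1 + ‖y‖) ^ s / 2` around them are pairwise disjoint. -/
def IsWeightedPacking {E : Type*} [NormedAddCommGroup E] (h s : ℝ) (t : Finset E) : Prop :=
  (∀ y ∈ t, h * (1 + ‖y‖) ^ s ≤ 1 + ‖y‖) ∧
    (t : Set E).PairwiseDisjoint fun y => ball y (h * (1 + ‖y‖) ^ s / 2)

lemma one_add_norm_le_of_mem_ball {E : Type*} [NormedAddCommGroup E] {h s : ℝ} {y z : E}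
    (hy : h * (1 + ‖y‖) ^ s ≤ 1 + ‖y‖) (hz : z ∈ ball y (h * (1 + ‖y‖) ^ s / 2)) :
    1 + ‖z‖ ≤ 3 / 2 * (1 + ‖y‖) ∧ 1 + ‖y‖ ≤ 2 * (1 + ‖z‖) := by
  rw [mem_ball_iff_norm] at hz
  have h1 := norm_sub_norm_le z y
  have h2 := norm_sub_norm_le y z
  rw [norm_sub_rev] at h2
  constructor <;> linarith

/-- A packing of maximal cardinality is a covering at a comparable scale. -/
lemma exists_weighted_cover_of_packing_bound {E : Type*} [NormedAddCommGroup E] {h s : ℝ}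
    (hh : 0 < h) (hs : 1 < s) {N : ℕ} (hN : 1 ≤ N)
    (hb : ∀ t : Finset E, IsWeightedPacking h s t → t.card ≤ N) :
    ∃ t : Finset E, t.Nonempty ∧ t.card ≤ N ∧
      ∀ x, ∃ y ∈ t, dist y x ≤ 3 ^ s * h * (1 + ‖x‖) ^ s := by
  classical
  have h3 : (3 : ℝ) ≤ 3 ^ s := Real.self_le_rpow_of_one_le (by norm_num) hs.le
  by_cases hD : ∃ y : E, h * (1 + ‖y‖) ^ s ≤ 1 + ‖y‖
  swap
  · push Not at hD
    refine ⟨{0}, by simp, by simpa using hN, fun x => ⟨0, by simp, ?_⟩⟩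
    rw [dist_zero_left, mul_assoc]
    nlinarith [hD x, norm_nonneg x]
  obtain ⟨y₀, hy₀⟩ := hD
  let P : ℕ → Prop := fun k => ∃ t : Finset E, IsWeightedPacking h s t ∧ t.card = k
  have hP1 : P 1 := ⟨{y₀}, ⟨by simpa using hy₀, by simp⟩, by simp⟩
  obtain ⟨t, ht, htk⟩ : P (Nat.findGreatest P N) := Nat.findGreatest_spec hN hP1
  have hpos : 1 ≤ t.card := htk ▸ Nat.le_findGreatest hN hP1
  obtain ⟨y₁, hy₁⟩ := Finset.card_pos.1 hpos
  refine ⟨t, ⟨y₁, hy₁⟩, hb t ht, fun x => ?_⟩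
  have hxp : 0 < 1 + ‖x‖ := by positivity
  have hrx : 0 < h * (1 + ‖x‖) ^ s := by positivity
  by_cases hx : h * (1 + ‖x‖) ^ s ≤ 1 + ‖x‖
  · by_cases hxt : x ∈ t
    · exact ⟨x, hxt, by rw [dist_self]; positivity⟩
    have hmeet : ∃ y ∈ t, ¬ Disjoint (ball x (h * (1 + ‖x‖) ^ s / 2))
        (ball y (h * (1 + ‖y‖) ^ s / 2)) := by
      by_contra! hcon
      have hins : IsWeightedPacking h s (insert x t) := by
        refine ⟨by simpa using ⟨hx, ht.1⟩, ?_⟩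
        rw [Finset.coe_insert]
        exact ht.2.insert fun y hy _ => hcon y hy
      have hle := Nat.le_findGreatest (P := P) (hb _ hins) ⟨_, hins, rfl⟩
      rw [Finset.card_insert_of_notMem hxt] at hle
      omega
    obtain ⟨y, hy, hne⟩ := hmeet
    obtain ⟨z, hzx, hzy⟩ := Set.not_disjoint_iff.1 hne
    refine ⟨y, hy, ?_⟩
    have hxz := (one_add_norm_le_of_mem_ball hx hzx).1
    have hyz := (one_add_norm_le_of_mem_ball (ht.1 y hy) hzy).2
    have hry : (1 + ‖y‖) ^ s ≤ 3 ^ s * (1 + ‖x‖) ^ s := by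
      rw [← Real.mul_rpow (by norm_num) hxp.le]
      exact Real.rpow_le_rpow (by positivity) (by linarith) (by linarith)
    have hd : dist y x ≤ dist z y + dist z x := by
      rw [dist_comm z y]; exact dist_triangle y z x
    rw [mem_ball] at hzx hzy
    have := mul_le_mul_of_nonneg_left hry hh.le
    nlinarith
  · push Not at hx
    refine ⟨y₁, hy₁, ?_⟩
    have hyx : ‖y₁‖ ≤ ‖x‖ := by
      by_contra! hlt
      have hyp : 0 < 1 + ‖y₁‖ := by positivity
      have e : ∀ a : ℝ, 0 < a → a ^ s = a * a ^ (s - 1) := fun a ha => by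
        rw [← Real.rpow_one_add' ha.le (by linarith)]; ring_nf
      have hm : (1 + ‖x‖) ^ (s - 1) ≤ (1 + ‖y₁‖) ^ (s - 1) :=
        Real.rpow_le_rpow hxp.le (by linarith) (by linarith)
      have hy := ht.1 y₁ hy₁
      rw [e _ hyp] at hy
      rw [e _ hxp] at hx
      have h1 : 1 < h * (1 + ‖x‖) ^ (s - 1) := by
        by_contra! hc; nlinarith
      have h2 : 1 < h * (1 + ‖y₁‖) ^ (s - 1) :=
        h1.trans_le (mul_le_mul_of_nonneg_left hm hh.le)
      nlinarith
    have := dist_le_norm_add_norm y₁ x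
    nlinarith [norm_nonneg x]

lemma exists_weighted_packing_bound {E : Type*} [NormedAddCommGroup E] [NormedSpace ℝ E]
    [FiniteDimensional ℝ E] [Nontrivial E] [MeasurableSpace E] [BorelSpace E] {s : ℝ}
    (hs : 1 < s) :
    ∃ K : ℝ, 0 < K ∧ ∀ h : ℝ, 0 < h → ∀ t : Finset E, IsWeightedPacking h s t →
      (t.card : ℝ) * h ^ finrank ℝ E ≤ K := by
  let μ : Measure E := Measure.addHaar
  let D := finrank ℝ E
  have hD : 0 < D := Module.finrank_pos
  let w : E → ℝ≥0∞ := fun x => ENNReal.ofReal ((1 + ‖x‖) ^ (-(s * D)))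
  have hI : ∫⁻ x, w x ∂μ < ⊤ := finite_integral_one_add_norm (by
    have : (0 : ℝ) < D := by exact_mod_cast hD
    change (D : ℝ) < s * D
    nlinarith)
  have hb0 : 0 < μ (ball 0 1) := measure_ball_pos μ 0 one_pos
  have hb1 : μ (ball 0 1) ≠ ⊤ := measure_ball_lt_top.ne
  let κ : ℝ := (2 : ℝ) ^ (-(s * D)) * (2⁻¹) ^ D * (μ (ball 0 1)).toReal
  have hκ : 0 < κ := by
    have := ENNReal.toReal_pos hb0.ne' hb1
    positivity
  refine ⟨(∫⁻ x, w x ∂μ).toReal / κ + 1, by positivity, fun h hh t ht => ?_⟩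
  have hball : ∀ y ∈ t, ENNReal.ofReal (κ * h ^ D) ≤
      ∫⁻ x in ball y (h * (1 + ‖y‖) ^ s / 2), w x ∂μ := by
    intro y hy
    have hyp : 0 < 1 + ‖y‖ := by positivity
    calc ENNReal.ofReal (κ * h ^ D)
        = ENNReal.ofReal ((2 * (1 + ‖y‖)) ^ (-(s * D))) *
            μ (ball y (h * (1 + ‖y‖) ^ s / 2)) := by
          rw [Measure.addHaar_ball μ y (by positivity), ← ENNReal.ofReal_toReal hb1,
            ← ENNReal.ofReal_mul (by positivity), ← ENNReal.ofReal_mul (by positivity)]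
          congr 1
          rw [Real.mul_rpow (by norm_num) hyp.le, div_pow, mul_pow, ← Real.rpow_mul_natCast hyp.le]
          simp only [κ]
          have : (1 + ‖y‖) ^ (-(s * D)) * (1 + ‖y‖) ^ (s * D) = 1 := by
            rw [← Real.rpow_add hyp]; simp
          rw [inv_pow]
          change _ = (2 : ℝ) ^ (-(s * D)) * (1 + ‖y‖) ^ (-(s * D)) *
            (h ^ D * (1 + ‖y‖) ^ (s * D) / 2 ^ D * (μ (ball 0 1)).toReal)
          linear_combination -(2 : ℝ) ^ (-(s * D)) * h ^ D / 2 ^ D * (μ (ball 0 1)).toReal * this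
      _ = ∫⁻ _ in ball y (h * (1 + ‖y‖) ^ s / 2),
            ENNReal.ofReal ((2 * (1 + ‖y‖)) ^ (-(s * D))) ∂μ := by
          rw [setLIntegral_const]
      _ ≤ _ := by
          refine setLIntegral_mono (by fun_prop) fun x hx => ?_
          refine ENNReal.ofReal_le_ofReal ?_
          refine Real.rpow_le_rpow_of_nonpos (by positivity) ?_ (by
            simp only [Left.neg_nonpos_iff]; positivity)
          linarith [(one_add_norm_le_of_mem_ball (ht.1 y hy) hx).1]
  have hsum : ENNReal.ofReal (t.card * (κ * h ^ D)) ≤ ∫⁻ x, w x ∂μ := by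
    calc ENNReal.ofReal (t.card * (κ * h ^ D))
        = ∑ _y ∈ t, ENNReal.ofReal (κ * h ^ D) := by
          rw [Finset.sum_const, nsmul_eq_mul, ENNReal.ofReal_mul (by positivity),
            ENNReal.ofReal_natCast]
      _ ≤ ∑ y ∈ t, ∫⁻ x in ball y (h * (1 + ‖y‖) ^ s / 2), w x ∂μ := Finset.sum_le_sum hball
      _ = ∫⁻ x in ⋃ y ∈ t, ball y (h * (1 + ‖y‖) ^ s / 2), w x ∂μ :=
          (lintegral_biUnion_finset ht.2 (fun _ _ => measurableSet_ball) w).symm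
      _ ≤ _ := setLIntegral_le_lintegral _ _
  rw [ENNReal.ofReal_le_iff_le_toReal hI.ne] at hsum
  have : (t.card : ℝ) * h ^ D ≤ (∫⁻ x, w x ∂μ).toReal / κ := by
    rw [le_div_iff₀ hκ]; linarith
  change (t.card : ℝ) * h ^ D ≤ _
  linarith

lemma exists_finset_weighted_cover (E : Type*) [NormedAddCommGroup E] [NormedSpace ℝ E]
    [FiniteDimensional ℝ E] [Nontrivial E] {s : ℝ} (hs : 1 < s) :
    ∃ C : ℝ, 0 < C ∧ ∀ n : ℕ, 1 ≤ n → ∃ t : Finset E, t.Nonempty ∧ t.card ≤ n ∧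
      ∀ x, ∃ y ∈ t, dist y x ≤ C * (n : ℝ) ^ (-1 / (finrank ℝ E : ℝ)) * (1 + ‖x‖) ^ s := by
  borelize E
  obtain ⟨K, hK, hb⟩ := exists_weighted_packing_bound (E := E) hs
  have hD : finrank ℝ E ≠ 0 := Module.finrank_pos.ne'
  refine ⟨3 ^ s * K ^ (1 / (finrank ℝ E : ℝ)), by positivity, fun n hn => ?_⟩
  have hn0 : (0 : ℝ) < n := by exact_mod_cast hn
  let h : ℝ := K ^ (1 / (finrank ℝ E : ℝ)) * (n : ℝ) ^ (-1 / (finrank ℝ E : ℝ))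
  have hh : 0 < h := by positivity
  have hpow : h ^ finrank ℝ E = K * (n : ℝ)⁻¹ := by
    have hD' : (finrank ℝ E : ℝ) ≠ 0 := by exact_mod_cast hD
    rw [mul_pow, ← Real.rpow_mul_natCast hK.le, ← Real.rpow_mul_natCast hn0.le,
      div_mul_cancel₀ _ hD', div_mul_cancel₀ _ hD', Real.rpow_one, Real.rpow_neg_one]
  obtain ⟨t, ht, htn, hcov⟩ := exists_weighted_cover_of_packing_bound (E := E) hh hs hn
    fun t ht => by
      have h1 := hb h hh t ht
      rw [hpow] at h1
      have h2 : (t.card : ℝ) ≤ n := by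
        field_simp at h1
        linarith
      exact_mod_cast h2
  refine ⟨t, ht, htn, fun x => ?_⟩
  obtain ⟨y, hy, hyx⟩ := hcov x
  exact ⟨y, hy, by simpa only [h, mul_assoc] using hyx⟩

/-- Measurable projection onto a nonempty finite set with at most `n` points. -/
lemma exists_measurable_index_dist_le {E : Type*} [PseudoMetricSpace E] [MeasurableSpace E]
    [OpensMeasurableSpace E] {t : Finset E} (ht : t.Nonempty) {n : ℕ} (htn : t.card ≤ n) :
    ∃ (e : Fin n → E) (J : E → Fin n), Measurable J ∧
      ∀ x, ∀ y ∈ t, edist x (e (J x)) ≤ edist x y := by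
  obtain ⟨y₀, hy₀⟩ := ht
  have hc : 0 < t.card := Finset.card_pos.2 ⟨y₀, hy₀⟩
  let f : ℕ → E := fun k => if hk : k < t.card then t.equivFin.symm ⟨k, hk⟩ else y₀
  have hlt : ∀ x, SimpleFunc.nearestPtInd f (n - 1) x < n := fun x => by
    have := SimpleFunc.nearestPtInd_le f (n - 1) x
    omega
  refine ⟨fun i => f i, fun x => ⟨SimpleFunc.nearestPtInd f (n - 1) x, hlt x⟩, ?_, ?_⟩
  · refine measurable_to_countable' fun i => ?_
    have : (fun x => (⟨SimpleFunc.nearestPtInd f (n - 1) x, hlt x⟩ : Fin n)) ⁻¹' {i} =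
        SimpleFunc.nearestPtInd f (n - 1) ⁻¹' {(i : ℕ)} := by
      ext x; simp [Fin.ext_iff]
    rw [this]
    exact SimpleFunc.measurableSet_preimage _ _
  · intro x y hy
    have hk := (t.equivFin ⟨y, hy⟩).2
    have hf : f (t.equivFin ⟨y, hy⟩) = y := by simp [f]
    have h := SimpleFunc.edist_nearestPt_le f x
      (k := (t.equivFin ⟨y, hy⟩ : ℕ)) (N := n - 1) (by omega)
    rw [hf, edist_comm, edist_comm y] at h
    exact h

lemma map_comp_mem_discreteP {d n : ℕ} {μ : Measure (EuclideanSpace ℝ (Fin d))}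
    [IsProbabilityMeasure μ] {J : EuclideanSpace ℝ (Fin d) → Fin n} (hJ : Measurable J)
    (e : Fin n → EuclideanSpace ℝ (Fin d)) : μ.map (fun x => e (J x)) ∈ discreteP d n := by
  have hprob : IsProbabilityMeasure (μ.map J) := Measure.isProbabilityMeasure_map hJ.aemeasurable
  refine ⟨e, fun i => μ.map J {i}, ?_, ?_⟩
  · rw [sum_measure_singleton]; simp
  · have he : Measurable e := measurable_of_countable e
    change μ.map (e ∘ J) = _
    rw [← Measure.map_map he hJ]
    conv_lhs => rw [← Measure.sum_smul_dirac (μ.map J)]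
    rw [Measure.map_sum he.aemeasurable, Measure.sum_fintype]
    simp [Measure.map_smul, Measure.map_dirac]

lemma WppENN_map_le {E : Type*} [MeasurableSpace E] [PseudoEMetricSpace E]
    [OpensMeasurableSpace (E × E)] (p : ℝ) (μ : Measure E) {T : E → E} (hT : Measurable T) :
    WppENN p μ (μ.map T) ≤ ∫⁻ x, edist x (T x) ^ p ∂μ := by
  have hm : Measurable fun x => (x, T x) := measurable_id.prodMk hT
  refine (iInf₂_le (μ.map fun x => (x, T x)) ⟨?_, ?_⟩).trans_eq ?_
  · rw [lintegral_map (continuous_edist.measurable.pow_const p) hm]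
  · rw [Measure.map_map measurable_fst hm]; exact Measure.map_id
  · rw [Measure.map_map measurable_snd hm]; rfl

lemma one_add_rpow_le {a q : ℝ} (ha : 0 ≤ a) (hq : 0 ≤ q) :
    (1 + a) ^ q ≤ 2 ^ q * (1 + a ^ q) := by
  have h1 : 0 ≤ a ^ q := by positivity
  rcases le_total a 1 with h | h
  · calc (1 + a) ^ q ≤ 2 ^ q := Real.rpow_le_rpow (by positivity) (by linarith) hq
      _ ≤ _ := le_mul_of_one_le_right (by positivity) (by linarith)
  · calc (1 + a) ^ q ≤ (2 * a) ^ q := Real.rpow_le_rpow (by positivity) (by linarith) hq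
      _ = 2 ^ q * a ^ q := Real.mul_rpow (by norm_num) ha
      _ ≤ _ := by gcongr; linarith

lemma Mq_rpow {q : ℝ} (hq : q ≠ 0) {d : ℕ} (μ : Measure (EuclideanSpace ℝ (Fin d))) :
    Mq q μ ^ q = (moment q μ).toReal := by
  rw [Mq, ← Real.rpow_mul ENNReal.toReal_nonneg, one_div_mul_cancel hq, Real.rpow_one]

lemma lintegral_weighted_le {d : ℕ} {μ : Measure (EuclideanSpace ℝ (Fin d))}
    [IsProbabilityMeasure μ] {q : ℝ} (hq : 0 < q) (hμ : moment q μ ≠ ⊤) :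
    ∫⁻ x, ENNReal.ofReal ((1 + ‖x‖) ^ q) ∂μ ≤ ENNReal.ofReal (2 ^ q * (Mq q μ ^ q + 1)) := by
  calc ∫⁻ x, ENNReal.ofReal ((1 + ‖x‖) ^ q) ∂μ
      ≤ ∫⁻ x, ENNReal.ofReal (2 ^ q) * (1 + ENNReal.ofReal ‖x‖ ^ q) ∂μ := by
        refine lintegral_mono fun x => ?_
        rw [ENNReal.ofReal_rpow_of_nonneg (norm_nonneg x) hq.le, ← ENNReal.ofReal_one,
          ← ENNReal.ofReal_add (by norm_num) (by positivity), ← ENNReal.ofReal_mul (by positivity)]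
        exact ENNReal.ofReal_le_ofReal (one_add_rpow_le (norm_nonneg x) hq.le)
    _ = ENNReal.ofReal (2 ^ q) * (1 + moment q μ) := by
        rw [lintegral_const_mul _ (by fun_prop), lintegral_add_left measurable_const]
        simp [moment]
    _ = _ := by
        rw [Mq_rpow hq.ne', ENNReal.ofReal_mul (by positivity),
          ENNReal.ofReal_add ENNReal.toReal_nonneg (by norm_num), ENNReal.ofReal_toReal hμ,
          ENNReal.ofReal_one, add_comm]

/-- Pierce's lemma: a measure with finite `q`-moment, `q > p`, is quantized at rate `n ^ (-1 / d)`
in `p`-th Wasserstein distance. -/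
lemma exists_iInf_Wdist_le {p q : ℝ} {d : ℕ} (hd : 0 < d) (hp : 0 < p) (hpq : p < q) :
    ∃ C : ℝ, 0 < C ∧
      ∀ μ : Measure (EuclideanSpace ℝ (Fin d)), IsProbabilityMeasure μ → moment q μ ≠ ⊤ →
        ∀ n : ℕ, 1 ≤ n → (⨅ γ ∈ discreteP d n, Wdist p μ γ) ≤
          ENNReal.ofReal (C * (Mq q μ ^ q + 1) ^ (1 / p) * (n : ℝ) ^ (-1 / (d : ℝ))) := by
  have hq : 0 < q := hp.trans hpq
  have : Nonempty (Fin d) := ⟨⟨0, hd⟩⟩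
  obtain ⟨C, hC, hcov⟩ := exists_finset_weighted_cover (EuclideanSpace ℝ (Fin d))
    ((one_lt_div hp).2 hpq)
  rw [finrank_euclideanSpace_fin] at hcov
  refine ⟨C * (2 ^ q) ^ (1 / p), by positivity, fun μ hμp hμ n hn => ?_⟩
  have hn0 : (0 : ℝ) < n := by exact_mod_cast hn
  obtain ⟨t, ht, htn, hdist⟩ := hcov n hn
  obtain ⟨e, J, hJ, hnear⟩ := exists_measurable_index_dist_le ht htn
  have hT : Measurable fun x => e (J x) := (measurable_of_countable e).comp hJ
  refine (iInf₂_le _ (map_comp_mem_discreteP (μ := μ) hJ e)).trans ?_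
  set A : ℝ := C * (n : ℝ) ^ (-1 / (d : ℝ)) with hA
  have hA0 : 0 < A := by positivity
  have hM : 0 ≤ Mq q μ ^ q := by rw [Mq_rpow hq.ne']; exact ENNReal.toReal_nonneg
  have hcost : WppENN p μ (μ.map fun x => e (J x)) ≤
      ENNReal.ofReal (A ^ p * (2 ^ q * (Mq q μ ^ q + 1))) := by
    calc WppENN p μ (μ.map fun x => e (J x))
        ≤ ∫⁻ x, edist x (e (J x)) ^ p ∂μ := WppENN_map_le p μ hT
      _ ≤ ∫⁻ x, ENNReal.ofReal (A ^ p) * ENNReal.ofReal ((1 + ‖x‖) ^ q) ∂μ := by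
          refine lintegral_mono fun x => ?_
          obtain ⟨y, hy, hyx⟩ := hdist x
          have h1 : edist x (e (J x)) ≤ ENNReal.ofReal (A * (1 + ‖x‖) ^ (q / p)) := by
            refine (hnear x y hy).trans ?_
            rw [edist_dist, dist_comm]
            exact ENNReal.ofReal_le_ofReal hyx
          refine (ENNReal.rpow_le_rpow h1 hp.le).trans_eq ?_
          rw [ENNReal.ofReal_rpow_of_nonneg (by positivity) hp.le,
            Real.mul_rpow hA0.le (by positivity), ← Real.rpow_mul (by positivity),
            div_mul_cancel₀ _ hp.ne', ENNReal.ofReal_mul (by positivity)]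
      _ ≤ _ := by
          rw [lintegral_const_mul _ (by fun_prop), ENNReal.ofReal_mul (by positivity)]
          gcongr
          exact lintegral_weighted_le hq hμ
  rw [Wdist]
  refine (ENNReal.rpow_le_rpow hcost (by positivity)).trans_eq ?_
  rw [ENNReal.ofReal_rpow_of_nonneg (by positivity) (by positivity),
    Real.mul_rpow (x := A ^ p) (by positivity) (by positivity),
    Real.mul_rpow (x := 2 ^ q) (by positivity) (by positivity),
    ← Real.rpow_mul hA0.le, mul_one_div_cancel hp.ne', Real.rpow_one, hA]
  congr 1
  ring

/-- Theorem: approximation of a distribution with finite moment by discrete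
distributions in Wasserstein distance. -/
theorem statement9 (p q : ℝ) (d : ℕ) (hd : 0 < d) (hp : 1 ≤ p) (hpq : p < q) :
    ∃ C : ℝ, 0 < C ∧
      ∀ μ : Measure (EuclideanSpace ℝ (Fin d)), IsProbabilityMeasure μ →
        moment q μ ≠ ⊤ →
        (p + p / d < q → ∀ n : ℕ, 1 ≤ n →
          (⨅ γ ∈ discreteP d n, Wdist p μ γ) ≤
            ENNReal.ofReal (C * (Mq q μ ^ q + 1) ^ (1 / p) * (n : ℝ) ^ (-1 / (d : ℝ)))) ∧
        (q ≤ p + p / d → ∀ n : ℕ, 2 ≤ n →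
          (⨅ γ ∈ discreteP d n, Wdist p μ γ) ≤
            ENNReal.ofReal (C * (Mq q μ ^ q + 1) ^ (1 / p) *
              ((n : ℝ) / Real.logb 2 (n : ℝ)) ^ (-1 / (d : ℝ)))) := by
  have hp0 : 0 < p := zero_lt_one.trans_le hp
  obtain ⟨C, hC, hbound⟩ := exists_iInf_Wdist_le hd hp0 hpq
  refine ⟨C, hC, fun μ hμp hμ => ⟨fun _ n hn => hbound μ hμp hμ n hn, fun _ n hn => ?_⟩⟩
  have hn2 : (2 : ℝ) ≤ n := by exact_mod_cast hn
  have hlog : 1 ≤ Real.logb 2 n := by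
    rw [Real.le_logb_iff_rpow_le (by norm_num) (by linarith)]
    simpa using hn2
  have hM : 0 ≤ Mq q μ ^ q := by
    rw [Mq_rpow (hp0.trans hpq).ne']; exact ENNReal.toReal_nonneg
  refine (hbound μ hμp hμ n (by omega)).trans (ENNReal.ofReal_le_ofReal ?_)
  refine mul_le_mul_of_nonneg_left ?_ (by positivity)
  refine Real.rpow_le_rpow_of_nonpos (by positivity) (div_le_self (by linarith) hlog) ?_
  exact div_nonpos_of_nonpos_of_nonneg (by norm_num) (by positivity)
end
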